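/- arXiv:1107.0088 — 3 statements merged into one kernel-verified Lean document; each statement's English description precedes it below -/
import Mathlib

section
/- Let B_1, ..., B_m be symmetric positive semidefinite n×n real matrices and set B := B_1 + ... + B_m. Then there is a universal constant C such that for every ε ∈ (0,1) there exists a vector y ∈ ℝ^m with y ≥ 0, at most C·n/ε² nonzero entries, and B ⪯ Σ_{i=1}^m y_i B_i ⪯ (1+ε)·B. -/
open Finset

namespace Matrix

variable {n ι : Type*} [Fintype n] [DecidableEq n]

theorem PosSemidef.trace_mul_nonneg {X Y : Matrix n n ℝ} (hX : X.PosSemidef)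
    (hY : Y.PosSemidef) : 0 ≤ (X * Y).trace := by
  obtain ⟨Z, rfl⟩ : ∃ Z : Matrix n n ℝ, X = Zᴴ * Z := by
    open scoped MatrixOrder in exact CStarAlgebra.nonneg_iff_eq_star_mul_self.mp hX.nonneg
  rw [Matrix.mul_assoc, Matrix.trace_mul_comm]
  exact (hY.mul_mul_conjTranspose_same Z).trace_nonneg

theorem PosSemidef.mul_eq_zero_of_conj_eq_zero {X N : Matrix n n ℝ} (hX : X.PosSemidef)
    (h : Nᴴ * X * N = 0) : X * N = 0 := by
  obtain ⟨Z, rfl⟩ : ∃ Z : Matrix n n ℝ, X = Zᴴ * Z := by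
    open scoped MatrixOrder in exact CStarAlgebra.nonneg_iff_eq_star_mul_self.mp hX.nonneg
  have : (Z * N)ᴴ * (Z * N) = 0 := by
    rw [conjTranspose_mul, ← h]; simp only [Matrix.mul_assoc]
  rw [Matrix.mul_assoc, conjTranspose_mul_self_eq_zero.mp this, Matrix.mul_zero]

theorem PosDef.mul_inv_cancel' {M : Matrix n n ℝ} (hM : M.PosDef) : M * M⁻¹ = 1 :=
  M.mul_nonsing_inv ((isUnit_iff_isUnit_det M).mp hM.isUnit)

theorem PosDef.inv_mul_cancel' {M : Matrix n n ℝ} (hM : M.PosDef) : M⁻¹ * M = 1 :=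
  M.nonsing_inv_mul ((isUnit_iff_isUnit_det M).mp hM.isUnit)

theorem PosDef.sq_dotProduct_le {M : Matrix n n ℝ} (hM : M.PosDef) (v w : n → ℝ) :
    (v ⬝ᵥ w) ^ 2 ≤ (v ⬝ᵥ M *ᵥ v) * (w ⬝ᵥ M⁻¹ *ᵥ w) := by
  have key (t : ℝ) : 0 ≤ w ⬝ᵥ M⁻¹ *ᵥ w - 2 * t * (v ⬝ᵥ w) + t ^ 2 * (v ⬝ᵥ M *ᵥ v) := by
    have h := hM.inv.posSemidef.dotProduct_mulVec_nonneg (w - t • M *ᵥ v)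
    have h1 : M⁻¹ *ᵥ M *ᵥ v = v := by rw [mulVec_mulVec, hM.inv_mul_cancel', one_mulVec]
    have h2 : (M *ᵥ v) ⬝ᵥ M⁻¹ *ᵥ w = v ⬝ᵥ w := by
      have hs : Mᵀ = M := by simpa using hM.isHermitian.eq
      rw [← hs, ← vecMul_transpose, transpose_transpose, ← dotProduct_mulVec, mulVec_mulVec, hs,
        hM.mul_inv_cancel', one_mulVec]
    simp only [star_trivial, mulVec_sub, mulVec_smul, h1, sub_dotProduct, dotProduct_sub,
      smul_dotProduct, dotProduct_smul, smul_eq_mul, h2] at h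
    rw [dotProduct_comm w v, dotProduct_comm (M *ᵥ v) v] at h
    linarith
  by_cases hv : v = 0
  · simp [hv]
  have hp : 0 < v ⬝ᵥ M *ᵥ v := by simpa using hM.dotProduct_mulVec_pos hv
  have h := key ((v ⬝ᵥ w) / (v ⬝ᵥ M *ᵥ v))
  field_simp at h
  nlinarith

/-- A positive semidefinite `X` satisfies `X ⪯ tr(M⁻¹ X) M`. -/
theorem PosSemidef.trace_inv_mul_smul_sub {M X : Matrix n n ℝ} (hX : X.PosSemidef)
    (hM : M.PosDef) : ((M⁻¹ * X).trace • M - X).PosSemidef := by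
  refine .of_dotProduct_mulVec_nonneg ?_ fun v => ?_
  · exact (hM.isHermitian.smul (by simp [IsSelfAdjoint])).sub hX.isHermitian
  by_cases hv : v = 0
  · simp [hv]
  have hp : 0 < v ⬝ᵥ M *ᵥ v := by simpa using hM.dotProduct_mulVec_pos hv
  have h : ((v ⬝ᵥ M *ᵥ v) • M⁻¹ - vecMulVec v v).PosSemidef := by
    refine .of_dotProduct_mulVec_nonneg ?_ fun w => ?_
    · refine (hM.inv.isHermitian.smul (by simp [IsSelfAdjoint])).sub ?_
      simpa using (posSemidef_vecMulVec_self_star v).isHermitian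
    · have := hM.sq_dotProduct_le v w
      simp [sub_mulVec, dotProduct_sub, smul_mulVec, vecMulVec_mulVec, dotProduct_comm w v]
      nlinarith
  have := h.trace_mul_nonneg hX
  simp [sub_mul, vecMulVec_mul, trace_vecMulVec] at this
  simp [sub_mulVec, smul_mulVec]
  rw [dotProduct_comm v (v ᵥ* X), ← dotProduct_mulVec] at this
  linarith

/-- If `X ⪯ a P` then `X P⁻¹ X ⪯ a X`. -/
theorem PosSemidef.smul_sub_mul_inv_mul {P X : Matrix n n ℝ} {a : ℝ} (hX : X.PosSemidef)
    (hP : P.PosDef) (ha : 0 ≤ a) (h : (a • P - X).PosSemidef) :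
    (a • X - X * P⁻¹ * X).PosSemidef := by
  rcases ha.eq_or_lt with rfl | ha
  · have : X = 0 := by
      open scoped MatrixOrder in
      refine le_antisymm ?_ hX.nonneg
      simpa [le_iff] using h
    simpa [this] using PosSemidef.zero
  have hPi : (P⁻¹)ᴴ = P⁻¹ := hP.inv.isHermitian.eq
  have h1 := hX.mul_mul_conjTranspose_same ((a • P - X) * P⁻¹)
  have h2 := h.mul_mul_conjTranspose_same (X * P⁻¹)
  have e : a • X - X * P⁻¹ * X = a⁻¹ • ((a • P - X) * P⁻¹ * X * ((a • P - X) * P⁻¹)ᴴ +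
      X * P⁻¹ * (a • P - X) * (X * P⁻¹)ᴴ) := by
    rw [conjTranspose_mul, conjTranspose_mul, hPi, h.isHermitian.eq, hX.isHermitian.eq]
    have e1 : (a • P - X) * P⁻¹ = a • 1 - X * P⁻¹ := by
      rw [sub_mul, smul_mul_assoc, hP.mul_inv_cancel']
    have e2 : P⁻¹ * (a • P - X) = a • 1 - P⁻¹ * X := by
      rw [mul_sub, mul_smul_comm, hP.inv_mul_cancel']
    rw [eq_inv_smul_iff₀ ha.ne', e2, Matrix.mul_assoc X P⁻¹ (a • P - X), e1, e2]
    simp only [sub_mul, mul_sub, smul_mul_assoc, mul_smul_comm, Matrix.one_mul, Matrix.mul_one,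
      smul_sub, Matrix.mul_assoc]
    abel
  rw [e]
  exact (h1.add h2).smul (inv_nonneg.mpr ha.le)

theorem inv_eq_add_of_sub {M P X : Matrix n n ℝ} (hM : M.PosDef) (hP : P.PosDef)
    (h : M = P + X) :
    P⁻¹ = M⁻¹ + M⁻¹ * X * M⁻¹ + M⁻¹ * (X * P⁻¹ * X) * M⁻¹ := by
  have h1 : P⁻¹ = M⁻¹ + M⁻¹ * X * P⁻¹ := by
    calc P⁻¹ = M⁻¹ * M * P⁻¹ := by rw [hM.inv_mul_cancel', one_mul]
      _ = M⁻¹ * (P * P⁻¹) + M⁻¹ * X * P⁻¹ := by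
        conv_lhs => enter [1, 2]; rw [h]
        noncomm_ring
      _ = _ := by rw [hP.mul_inv_cancel', mul_one]
  have h2 : P⁻¹ = M⁻¹ + P⁻¹ * X * M⁻¹ := by
    calc P⁻¹ = P⁻¹ * (M * M⁻¹) := by rw [hM.mul_inv_cancel', mul_one]
      _ = P⁻¹ * P * M⁻¹ + P⁻¹ * X * M⁻¹ := by
        conv_lhs => enter [2, 1]; rw [h]
        noncomm_ring
      _ = _ := by rw [hP.inv_mul_cancel', one_mul]
  nth_rewrite 1 [h1]
  nth_rewrite 1 [h2]
  noncomm_ring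

theorem PosSemidef.trace_conj_inv_nonneg {M X : Matrix n n ℝ} (hX : X.PosSemidef)
    (hM : M.PosDef) : 0 ≤ (M⁻¹ * X * M⁻¹).trace := by
  have := hX.mul_mul_conjTranspose_same M⁻¹
  rw [hM.inv.isHermitian.eq] at this
  exact this.trace_nonneg

theorem PosDef.sub_of_trace_lt_one {M X : Matrix n n ℝ} (hM : M.PosDef) (hX : X.PosSemidef)
    (hc : (M⁻¹ * X).trace < 1) : (M - X).PosDef ∧
      (M - X)⁻¹.trace ≤ M⁻¹.trace + (M⁻¹ * X * M⁻¹).trace / (1 - (M⁻¹ * X).trace) := by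
  have hcM := hX.trace_inv_mul_smul_sub hM
  have hc0 := hM.inv.posSemidef.trace_mul_nonneg hX
  set c := (M⁻¹ * X).trace
  have hc1 : 0 < 1 - c := by linarith
  have hP : (M - X).PosDef := by
    have := (hM.smul hc1).add_posSemidef hcM
    convert this using 1
    module
  refine ⟨hP, ?_⟩
  have h := hX.smul_sub_mul_inv_mul (a := c / (1 - c)) hP (by positivity) (by
    convert hcM.smul (inv_nonneg.mpr hc1.le) using 1
    match_scalars <;> field_simp
    ring)
  have ht := h.trace_conj_inv_nonneg hM
  rw [inv_eq_add_of_sub hM hP (sub_add_cancel M X).symm]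
  simp only [mul_sub, sub_mul, mul_smul_comm, smul_mul_assoc, trace_sub, trace_smul, trace_add,
    smul_eq_mul] at ht ⊢
  have : (M⁻¹ * X * M⁻¹).trace / (1 - c) =
      (M⁻¹ * X * M⁻¹).trace + c / (1 - c) * (M⁻¹ * X * M⁻¹).trace := by
    field_simp
    ring
  linarith

theorem PosDef.trace_inv_add_le {M X : Matrix n n ℝ} (hM : M.PosDef) (hX : X.PosSemidef) :
    (M + X)⁻¹.trace ≤ M⁻¹.trace - (M⁻¹ * X * M⁻¹).trace / (1 + (M⁻¹ * X).trace) := by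
  have hcM := hX.trace_inv_mul_smul_sub hM
  have hc0 := hM.inv.posSemidef.trace_mul_nonneg hX
  set c := (M⁻¹ * X).trace
  have hP : (M + X).PosDef := hM.add_posSemidef hX
  have hc1 : 0 < 1 + c := by linarith
  have h := hX.smul_sub_mul_inv_mul (a := c / (1 + c)) hP (by positivity) (by
    convert hcM.smul (inv_nonneg.mpr hc1.le) using 1
    match_scalars <;> field_simp
    ring)
  have ht := h.trace_conj_inv_nonneg hM
  rw [inv_eq_add_of_sub (X := -X) hM hP (by abel)]
  simp only [mul_sub, sub_mul, mul_smul_comm, smul_mul_assoc, trace_sub, trace_smul, trace_add,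
    smul_eq_mul, mul_neg, neg_mul, neg_neg, trace_neg] at ht ⊢
  have : (M⁻¹ * X * M⁻¹).trace / (1 + c) =
      (M⁻¹ * X * M⁻¹).trace - c / (1 + c) * (M⁻¹ * X * M⁻¹).trace := by
    field_simp
    ring
  linarith

theorem PosDef.sub_one_of_trace_inv_le {N : Matrix n n ℝ} {a : ℝ} (hN : N.PosDef) (ha : a < 1)
    (h : N⁻¹.trace ≤ a) : (N - 1).PosDef := by
  have := (PosSemidef.one (n := n) (R := ℝ)).trace_inv_mul_smul_sub hN
  rw [mul_one] at this
  have h2 := (hN.smul (sub_pos.mpr (h.trans_lt ha))).add_posSemidef this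
  convert h2 using 1
  module

theorem PosDef.lower_barrier_shift [Nonempty n] {N : Matrix n n ℝ} {a : ℝ} (hN : N.PosDef)
    (hM : (N - 1).PosDef) (ha : a < 1) (h : N⁻¹.trace ≤ a) :
    0 < (N - 1)⁻¹.trace - N⁻¹.trace ∧
      ((N - 1)⁻¹.trace - N⁻¹.trace) * (1 - a + (N - 1)⁻¹.trace) <
        ((N - 1)⁻¹ * (N - 1)⁻¹).trace := by
  set M := N - 1 with hMd
  have e1 : M⁻¹ - N⁻¹ = M⁻¹ * N⁻¹ := by
    calc M⁻¹ - N⁻¹ = M⁻¹ * (N * N⁻¹) - M⁻¹ * M * N⁻¹ := by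
          rw [hN.mul_inv_cancel', hM.inv_mul_cancel']; simp
      _ = M⁻¹ * (N - M) * N⁻¹ := by noncomm_ring
      _ = _ := by rw [hMd, sub_sub_cancel, mul_one]
  have e2 : M⁻¹ - N⁻¹ = N⁻¹ * M⁻¹ := by
    calc M⁻¹ - N⁻¹ = N⁻¹ * N * M⁻¹ - N⁻¹ * (M * M⁻¹) := by
          rw [hN.inv_mul_cancel', hM.mul_inv_cancel']; simp
      _ = N⁻¹ * (N - M) * M⁻¹ := by noncomm_ring
      _ = _ := by rw [hMd, sub_sub_cancel, mul_one]
  have e3 : M⁻¹ * M⁻¹ = M⁻¹ - N⁻¹ + M⁻¹ * N⁻¹ * M⁻¹ := by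
    rw [mul_assoc, ← e2, mul_sub, ← e1]; abel
  have hE : (M⁻¹ * M⁻¹).trace = M⁻¹.trace - N⁻¹.trace + (M⁻¹ * N⁻¹ * M⁻¹).trace := by
    rw [e3]; simp
  have hD : 0 < M⁻¹.trace - N⁻¹.trace := by
    rw [← trace_sub]
    refine PosDef.trace_pos ?_
    have e4 : M⁻¹ - N⁻¹ = N⁻¹ * N⁻¹ + N⁻¹ * M⁻¹ * N⁻¹ := by
      rw [← e2, sub_mul, ← e1]; abel
    rw [e4]
    have hNi := hN.inv.isHermitian.eq
    have hinj : Function.Injective (N⁻¹).mulVec :=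
      mulVec_injective_of_isUnit hN.inv.isUnit
    have h1 := PosDef.conjTranspose_mul_self N⁻¹ hinj
    have h2 := hM.inv.posSemidef.conjTranspose_mul_mul_same N⁻¹
    rw [hNi] at h1 h2
    exact h1.add_posSemidef h2
  refine ⟨hD, ?_⟩
  set D := M⁻¹.trace - N⁻¹.trace
  have hq := (hN.inv.posSemidef.conjTranspose_mul_mul_same (D • 1 - M⁻¹)).trace_nonneg
  have e5 : (D • 1 - M⁻¹)ᴴ * N⁻¹ * (D • 1 - M⁻¹) =
      (D * D) • N⁻¹ - D • (M⁻¹ - N⁻¹) - D • (M⁻¹ - N⁻¹) + M⁻¹ * N⁻¹ * M⁻¹ := by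
    have hMi := hM.inv.isHermitian.eq
    rw [conjTranspose_sub, hMi, conjTranspose_smul, conjTranspose_one, star_trivial]
    nth_rewrite 1 [e1]
    rw [e2]
    simp only [sub_mul, mul_sub, smul_mul_assoc, mul_smul_comm, one_mul, mul_one, smul_sub,
      smul_smul]
    abel
  rw [e5] at hq
  simp only [trace_add, trace_sub, trace_smul, smul_eq_mul] at hq
  rw [hE]
  have hS : M⁻¹.trace = D + N⁻¹.trace := by simp [D]
  have hDD : M⁻¹.trace - N⁻¹.trace = D := rfl
  rw [hS] at hq ⊢
  nlinarith [mul_pos hD hD, mul_le_mul_of_nonneg_left h (mul_pos hD hD).le,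
    mul_le_mul_of_nonneg_left h hD.le, mul_lt_mul_of_pos_left ha (mul_pos hD hD)]

theorem PosDef.upper_barrier_shift [Nonempty n] {N : Matrix n n ℝ} {a δ : ℝ} (hN : N.PosDef)
    (hM : (N + δ • 1).PosDef) (hδ : 0 < δ) (h : N⁻¹.trace ≤ a) :
    0 < N⁻¹.trace - (N + δ • 1)⁻¹.trace ∧
      ((N + δ • 1)⁻¹ * (N + δ • 1)⁻¹).trace ≤
        (N⁻¹.trace - (N + δ • 1)⁻¹.trace) * (1 / δ + a - (N + δ • 1)⁻¹.trace) := by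
  set M := N + δ • 1 with hMd
  have e1 : N⁻¹ - M⁻¹ = δ • (M⁻¹ * N⁻¹) := by
    calc N⁻¹ - M⁻¹ = M⁻¹ * M * N⁻¹ - M⁻¹ * (N * N⁻¹) := by
          rw [hN.mul_inv_cancel', hM.inv_mul_cancel']; simp
      _ = M⁻¹ * (M - N) * N⁻¹ := by noncomm_ring
      _ = _ := by rw [hMd, add_sub_cancel_left]; simp
  have e2 : N⁻¹ - M⁻¹ = δ • (N⁻¹ * M⁻¹) := by
    calc N⁻¹ - M⁻¹ = N⁻¹ * (M * M⁻¹) - N⁻¹ * N * M⁻¹ := by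
          rw [hN.inv_mul_cancel', hM.mul_inv_cancel']; simp
      _ = N⁻¹ * (M - N) * M⁻¹ := by noncomm_ring
      _ = _ := by rw [hMd, add_sub_cancel_left]; simp
  have hMi := hM.inv.isHermitian.eq
  have e3 : N⁻¹ - M⁻¹ = δ • (M⁻¹ * M⁻¹) + (δ * δ) • (M⁻¹ * N⁻¹ * M⁻¹) := by
    have : (δ * δ) • (M⁻¹ * N⁻¹ * M⁻¹) = δ • (M⁻¹ * (δ • (N⁻¹ * M⁻¹))) := by
      simp [smul_smul, mul_assoc]
    rw [this, ← e2, mul_sub, smul_sub, ← e1]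
    abel
  have h2 := hN.inv.posSemidef.conjTranspose_mul_mul_same M⁻¹
  have h1 := PosDef.conjTranspose_mul_self M⁻¹ (mulVec_injective_of_isUnit hM.inv.isUnit)
  rw [hMi] at h1 h2
  have t1 := h1.trace_pos
  have t2 := h2.trace_nonneg
  have hD : N⁻¹.trace - M⁻¹.trace =
      δ * (M⁻¹ * M⁻¹).trace + δ * δ * (M⁻¹ * N⁻¹ * M⁻¹).trace := by
    rw [← trace_sub, e3]; simp
  have hD0 : 0 < N⁻¹.trace - M⁻¹.trace := by rw [hD]; positivity
  refine ⟨hD0, ?_⟩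
  have h3 : (M⁻¹ * M⁻¹).trace ≤ (N⁻¹.trace - M⁻¹.trace) * (1 / δ) := by
    rw [hD]; field_simp
    nlinarith [mul_nonneg hδ.le t2]
  have h4 : 0 ≤ (N⁻¹.trace - M⁻¹.trace) * (a - M⁻¹.trace) :=
    mul_nonneg hD0.le (by linarith)
  linarith


theorem exists_barrier_step [Nonempty n] [Fintype ι] {C : ι → Matrix n n ℝ}
    (hC : ∀ i, (C i).PosSemidef) (hsum : ∑ i, C i = 1) {A : Matrix n n ℝ} {l u a δ : ℝ}
    (ha : a < 1) (hδ : 0 < δ) (hδa : 1 / δ + a ≤ 1 - a)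
    (hl : (A - l • 1).PosDef) (hla : (A - l • 1)⁻¹.trace ≤ a)
    (hu : (u • 1 - A).PosDef) (hua : (u • 1 - A)⁻¹.trace ≤ a) :
    ∃ (i : ι) (s : ℝ), 0 ≤ s ∧
      (A + s • C i - (l + 1) • 1).PosDef ∧ (A + s • C i - (l + 1) • 1)⁻¹.trace ≤ a ∧
      ((u + δ) • 1 - (A + s • C i)).PosDef ∧ ((u + δ) • 1 - (A + s • C i))⁻¹.trace ≤ a := by
  have hL := hl.sub_one_of_trace_inv_le ha hla
  have hU : (u • 1 - A + δ • 1).PosDef := hu.add_posSemidef (PosSemidef.one.smul hδ.le)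
  obtain ⟨hDL, hLs⟩ := hl.lower_barrier_shift hL ha hla
  obtain ⟨hDU, hUs⟩ := hu.upper_barrier_shift hU hδ hua
  set L := A - l • 1 - 1 with hLd
  set U := u • 1 - A + δ • 1 with hUd
  set DL := L⁻¹.trace - (A - l • 1)⁻¹.trace with hDLd
  set DU := (u • 1 - A)⁻¹.trace - U⁻¹.trace with hDUd
  have hconj (S : Matrix n n ℝ) : ∑ i, (S * C i * S).trace = (S * S).trace := by
    rw [← trace_sum, ← Finset.sum_mul, ← Finset.mul_sum, hsum, mul_one]
  have hlin (S : Matrix n n ℝ) : ∑ i, (S * C i).trace = S.trace := by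
    rw [← trace_sum, ← Finset.mul_sum, hsum, mul_one]
  obtain ⟨i, -, hi⟩ : ∃ i ∈ Finset.univ,
      (U⁻¹ * C i * U⁻¹).trace / DU + (U⁻¹ * C i).trace <
        (L⁻¹ * C i * L⁻¹).trace / DL - (L⁻¹ * C i).trace := by
    refine Finset.exists_lt_of_sum_lt ?_
    rw [Finset.sum_add_distrib, Finset.sum_sub_distrib, ← Finset.sum_div, ← Finset.sum_div,
      hconj, hconj, hlin, hlin]
    have h1 : (U⁻¹ * U⁻¹).trace / DU ≤ 1 / δ + a - U⁻¹.trace := by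
      rw [div_le_iff₀ hDU]; linarith
    have h2 : 1 - a + L⁻¹.trace < (L⁻¹ * L⁻¹).trace / DL := by
      rw [lt_div_iff₀ hDL]; linarith
    linarith
  have hU1 := (hC i).trace_conj_inv_nonneg hU
  have hU2 := hU.inv.posSemidef.trace_mul_nonneg (hC i)
  have hL2 := hL.inv.posSemidef.trace_mul_nonneg (hC i)
  set t := (L⁻¹ * C i * L⁻¹).trace / DL - (L⁻¹ * C i).trace with ht
  have hUt : (U⁻¹ * C i).trace < t := lt_of_le_of_lt (by
    have : 0 ≤ (U⁻¹ * C i * U⁻¹).trace / DU := by positivity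
    linarith) hi
  have ht0 : 0 < t := hU2.trans_lt hUt
  have hX : (t⁻¹ • C i).PosSemidef := (hC i).smul (inv_nonneg.mpr ht0.le)
  have eL : A + t⁻¹ • C i - (l + 1) • 1 = L + t⁻¹ • C i := by rw [hLd]; module
  have eU : (u + δ) • 1 - (A + t⁻¹ • C i) = U - t⁻¹ • C i := by rw [hUd]; module
  obtain ⟨hUX, hUXt⟩ := hU.sub_of_trace_lt_one hX (by
    rw [mul_smul_comm, trace_smul, smul_eq_mul, inv_mul_lt_iff₀ ht0]; linarith)
  have hLXt := hL.trace_inv_add_le hX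
  refine ⟨i, t⁻¹, inv_nonneg.mpr ht0.le, ?_, ?_, ?_, ?_⟩
  · rw [eL]; exact hL.add_posSemidef hX
  · rw [eL]
    refine hLXt.trans (le_trans ?_ hla)
    have : DL = (L⁻¹ * (t⁻¹ • C i) * L⁻¹).trace / (1 + (L⁻¹ * (t⁻¹ • C i)).trace) := by
      simp only [mul_smul_comm, smul_mul_assoc, trace_smul, smul_eq_mul]
      have : (L⁻¹ * C i * L⁻¹).trace = DL * (t + (L⁻¹ * C i).trace) := by
        rw [ht]; field_simp; ring
      rw [this]
      field_simp
    linarith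
  · rw [eU]; exact hUX
  · rw [eU]
    refine hUXt.trans (le_trans ?_ hua)
    have : (U⁻¹ * (t⁻¹ • C i) * U⁻¹).trace / (1 - (U⁻¹ * (t⁻¹ • C i)).trace) ≤ DU := by
      simp only [mul_smul_comm, smul_mul_assoc, trace_smul, smul_eq_mul]
      have h1 : 0 < t - (U⁻¹ * C i).trace := by linarith
      have h2 : (U⁻¹ * C i * U⁻¹).trace ≤ (t - (U⁻¹ * C i).trace) * DU := by
        rw [← div_le_iff₀ hDU]; linarith
      have h3 : t⁻¹ * (U⁻¹ * C i * U⁻¹).trace / (1 - t⁻¹ * (U⁻¹ * C i).trace) =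
          (U⁻¹ * C i * U⁻¹).trace / (t - (U⁻¹ * C i).trace) := by
        have h4 : 1 - t⁻¹ * (U⁻¹ * C i).trace = t⁻¹ * (t - (U⁻¹ * C i).trace) := by
          field_simp
        rw [h4, mul_div_mul_left _ _ (inv_ne_zero ht0.ne')]
      rw [h3, div_le_iff₀ h1]
      linarith
    linarith

theorem exists_barrier_iterate [Nonempty n] [Fintype ι] [DecidableEq ι] {C : ι → Matrix n n ℝ}
    (hC : ∀ i, (C i).PosSemidef) (hsum : ∑ i, C i = 1) {r a δ : ℝ} (hr : 0 < r)
    (hra : Fintype.card n / r ≤ a) (ha : a < 1) (hδ : 0 < δ) (hδa : 1 / δ + a ≤ 1 - a) (T : ℕ) :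
    ∃ y : ι → ℝ, (∀ i, 0 ≤ y i) ∧ #{i | y i ≠ 0} ≤ T ∧
      (∑ i, y i • C i - (-r + T) • 1).PosDef ∧
      (∑ i, y i • C i - (-r + T) • 1)⁻¹.trace ≤ a ∧
      ((r + T * δ) • 1 - ∑ i, y i • C i).PosDef ∧
      ((r + T * δ) • 1 - ∑ i, y i • C i)⁻¹.trace ≤ a := by
  induction T with
  | zero =>
    have hP : (r • (1 : Matrix n n ℝ)).PosDef := PosDef.one.smul hr
    have hi : (r • (1 : Matrix n n ℝ))⁻¹ = r⁻¹ • 1 :=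
      inv_eq_left_inv (by simp [smul_smul, hr.ne'])
    have ht : (r • (1 : Matrix n n ℝ))⁻¹.trace ≤ a := by
      rw [hi, trace_smul, trace_one, smul_eq_mul, ← div_eq_inv_mul]
      exact hra
    refine ⟨0, by simp, by simp, ?_⟩
    simpa using And.intro hP (And.intro ht (And.intro hP ht))
  | succ T ih =>
    obtain ⟨y, hy, hcard, h1, h2, h3, h4⟩ := ih
    obtain ⟨i, s, hs, g1, g2, g3, g4⟩ :=
      exists_barrier_step hC hsum ha hδ hδa h1 h2 h3 h4
    have e : ∑ j, (y + Pi.single i s : ι → ℝ) j • C j = ∑ j, y j • C j + s • C i := by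
      simp only [Pi.add_apply, add_smul, Finset.sum_add_distrib]
      congr 1
      rw [Finset.sum_eq_single i]
      · simp
      · intro j _ hj; simp [hj]
      · simp
    refine ⟨y + Pi.single i s, fun j => add_nonneg (hy j) ?_, ?_, ?_⟩
    · by_cases hj : j = i
      · subst hj; simpa using hs
      · simp [hj]
    · refine (Finset.card_le_card (t := insert i (univ.filter fun j => y j ≠ 0))
        fun j hj => ?_).trans ((Finset.card_insert_le _ _).trans (by omega))
      by_cases hji : j = i
      · simp [hji]
      · simpa [hji] using hj
    · have e1 : -r + ((T + 1 : ℕ) : ℝ) = -r + T + 1 := by push_cast; ring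
      have e2 : r + ((T + 1 : ℕ) : ℝ) * δ = r + T * δ + δ := by push_cast; ring
      rw [e, e1, e2]
      exact ⟨g1, g2, g3, g4⟩

theorem exists_sparsify_of_sum_eq_one [Fintype ι] {C : ι → Matrix n n ℝ}
    (hC : ∀ i, (C i).PosSemidef) (hsum : ∑ i, C i = 1) {ε : ℝ} (hε : 0 < ε) (hε1 : ε < 1) :
    ∃ y : ι → ℝ, (∀ i, 0 ≤ y i) ∧
      (#{i | y i ≠ 0} : ℝ) ≤ 49 * Fintype.card n / ε ^ 2 ∧
      (∑ i, y i • C i - 1).PosSemidef ∧ ((1 + ε) • 1 - ∑ i, y i • C i).PosSemidef := by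
  classical
  rcases isEmpty_or_nonempty n with hn | hn
  · refine ⟨0, by simp, by simp, ?_, ?_⟩ <;>
    · convert PosSemidef.zero (n := n) (R := ℝ)
      exact Subsingleton.elim _ _
  obtain ⟨k, hk⟩ : ∃ k : ℕ, k = ⌈2 + 4 / ε⌉₊ := ⟨_, rfl⟩
  have hk1 : 2 + 4 / ε ≤ k := hk ▸ Nat.le_ceil _
  have hk2 : (k : ℝ) < 2 + 4 / ε + 1 := hk ▸ Nat.ceil_lt_add_one (by positivity)
  have h4 : 4 < 4 / ε := by rw [lt_div_iff₀ hε]; linarith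
  have hk6 : (6 : ℝ) < k := by linarith
  have hkε : (k : ℝ) ≤ 7 / ε := by
    have : 3 < 3 / ε := by rw [lt_div_iff₀ hε]; linarith
    have : 7 / ε = 3 / ε + 4 / ε := by ring
    linarith
  have hN : (0 : ℝ) < Fintype.card n := by exact_mod_cast Fintype.card_pos
  set N : ℝ := (Fintype.card n : ℝ) with hNd
  have hk0 : (0 : ℝ) < k := by linarith
  have hk20 : (0 : ℝ) < k - 2 := by linarith
  obtain ⟨y, hy, hcard, hl, -, hu, -⟩ := exists_barrier_iterate hC hsum (r := k * N)
    (a := 1 / k) (δ := k / (k - 2)) (by positivity) (by rw [← hNd]; field_simp; rfl)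
    (by rw [div_lt_one hk0]; linarith) (by positivity)
    (by field_simp; linarith) (k ^ 2 * Fintype.card n)
  push_cast at hl hu
  rw [← hNd] at hl hu
  set c : ℝ := -(k * N) + k ^ 2 * N with hc
  have hc0 : 0 < c := by
    have : c = k * N * (k - 1) := by rw [hc]; ring
    rw [this]
    have : (0 : ℝ) < k - 1 := by linarith
    positivity
  have hsc : ∑ i, (c⁻¹ • y) i • C i = c⁻¹ • ∑ i, y i • C i := by
    simp [Finset.smul_sum, smul_smul]
  refine ⟨c⁻¹ • y, fun i => ?_, ?_, ?_, ?_⟩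
  · exact mul_nonneg (inv_nonneg.mpr hc0.le) (hy i)
  · have : #{i | (c⁻¹ • y) i ≠ 0} = #{i | y i ≠ 0} := by
      congr 1; ext i; simp [hc0.ne']
    rw [this]
    have h1 : (#{i | y i ≠ 0} : ℝ) ≤ k ^ 2 * N := by
      rw [hNd]; exact_mod_cast hcard
    have h2 : (k : ℝ) ^ 2 ≤ (7 / ε) ^ 2 := by gcongr
    have h3 : 49 * N / ε ^ 2 = (7 / ε) ^ 2 * N := by ring
    rw [h3]
    exact h1.trans (by gcongr)
  · rw [hsc]
    convert hl.posSemidef.smul (inv_nonneg.mpr hc0.le) using 1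
    rw [smul_sub, smul_smul, inv_mul_cancel₀ hc0.ne', one_smul]
  · rw [hsc]
    have hgap : 0 ≤ (1 + ε) - c⁻¹ * (k * N + k ^ 2 * N * (k / (k - 2))) := by
      have e : k * N + k ^ 2 * N * (k / (k - 2)) = c * ((k + 2) / (k - 2)) := by
        rw [hc]; field_simp; ring
      rw [e, inv_mul_cancel_left₀ hc0.ne', sub_nonneg, div_le_iff₀ hk20]
      have : 4 ≤ ε * (k - 2) := by
        have := mul_le_mul_of_nonneg_left hk1 hε.le
        rw [mul_add, mul_div_cancel₀ _ hε.ne'] at this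
        linarith
      linarith
    convert (hu.posSemidef.smul (inv_nonneg.mpr hc0.le)).add
      ((PosSemidef.one (n := n) (R := ℝ)).smul hgap) using 1
    module

theorem exists_sparsify_of_sum_eq_projection [Fintype ι] {C : ι → Matrix n n ℝ}
    (hC : ∀ i, (C i).PosSemidef) {Q : Matrix n n ℝ} (hQ : Qᴴ = Q) (hQQ : Q * Q = Q)
    (hsum : ∑ i, C i = Q) {ε : ℝ} (hε : 0 < ε) (hε1 : ε < 1) :
    ∃ y : ι → ℝ, (∀ i, 0 ≤ y i) ∧
      (#{i | y i ≠ 0} : ℝ) ≤ 49 * Fintype.card n / ε ^ 2 ∧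
      (∑ i, y i • C i - Q).PosSemidef ∧ ((1 + ε) • Q - ∑ i, y i • C i).PosSemidef := by
  classical
  set N : Matrix n n ℝ := 1 - Q with hNd
  have hNh : Nᴴ = N := by rw [hNd, conjTranspose_sub, conjTranspose_one, hQ]
  have hNN : N * N = N := by
    simp only [hNd, sub_mul, mul_sub, mul_one, one_mul, hQQ]; abel
  have hN : N.PosSemidef := by
    have := posSemidef_conjTranspose_mul_self N
    rwa [hNh, hNN] at this
  have hNQ : N * Q = 0 := by simp [hNd, sub_mul, hQQ]
  have hQN : Q * N = 0 := by simp [hNd, mul_sub, hQQ]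
  have hCN (i : ι) : C i * N = 0 := by
    refine (hC i).mul_eq_zero_of_conj_eq_zero ?_
    have hp (j : ι) : (Nᴴ * C j * N).PosSemidef := (hC j).conjTranspose_mul_mul_same N
    refine (hp i).trace_eq_zero_iff.mp ?_
    have h0 : ∑ j, (Nᴴ * C j * N).trace = 0 := by
      rw [← trace_sum, ← Finset.sum_mul, ← Finset.mul_sum, hsum, hNh, hNQ]; simp
    exact (Finset.sum_eq_zero_iff_of_nonneg fun j _ => (hp j).trace_nonneg).mp h0 i
      (Finset.mem_univ i)
  have hCQ (i : ι) : C i * Q = C i := by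
    have := hCN i
    rw [hNd, mul_sub, mul_one, sub_eq_zero] at this
    exact this.symm
  have hQC (i : ι) : Q * C i = C i := by
    have := congrArg conjTranspose (hCQ i)
    rwa [conjTranspose_mul, hQ, (hC i).isHermitian.eq] at this
  obtain ⟨y, hy, hcard, h1, h2⟩ := exists_sparsify_of_sum_eq_one
    (C := fun o : Option ι => o.elim N C) (fun o => by cases o; exacts [hN, hC _])
    (by rw [Fintype.sum_option]; simp [hsum, hNd]) hε hε1
  have hconj : Q * (∑ o : Option ι, y o • (o.elim N C)) * Q = ∑ i, y (some i) • C i := by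
    rw [Fintype.sum_option]
    simp [mul_add, hQN, Finset.mul_sum, Finset.sum_mul, hQC, hCQ]
  refine ⟨fun i => y (some i), fun i => hy _, le_trans ?_ hcard, ?_, ?_⟩
  · refine Nat.cast_le.mpr (Finset.card_le_card_of_injOn some ?_ (Option.some_injective _).injOn)
    intro i hi
    simpa using hi
  · have := h1.conjTranspose_mul_mul_same Q
    rwa [hQ, mul_sub, sub_mul, hconj, mul_one, hQQ] at this
  · have := h2.conjTranspose_mul_mul_same Q
    rwa [hQ, mul_sub, sub_mul, hconj, mul_smul_comm, smul_mul_assoc, mul_one, hQQ] at this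

/-- A positive semidefinite matrix is congruent to an orthogonal projection. -/
theorem PosSemidef.exists_congruent_projection {B : Matrix n n ℝ} (hB : B.PosSemidef) :
    ∃ V W Q : Matrix n n ℝ, V * W = 1 ∧ Vᴴ * B * V = Q ∧ Qᴴ = Q ∧ Q * Q = Q := by
  set U : Matrix n n ℝ := (hB.isHermitian.eigenvectorUnitary : Matrix n n ℝ)
  set d := hB.isHermitian.eigenvalues
  have hUU : Uᴴ * U = 1 := Unitary.coe_star_mul_self hB.isHermitian.eigenvectorUnitary
  have hUU' : U * Uᴴ = 1 := Unitary.coe_mul_star_self hB.isHermitian.eigenvectorUnitary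
  have hd : ∀ i, 0 ≤ d i := hB.eigenvalues_nonneg
  have hBd : Uᴴ * B * U = diagonal d := by
    have h : B = U * diagonal d * Uᴴ := hB.isHermitian.spectral_theorem
    have e : Uᴴ * (U * diagonal d * Uᴴ) * U = (Uᴴ * U) * diagonal d * (Uᴴ * U) := by
      simp only [mul_assoc]
    rw [h, e, hUU, one_mul, mul_one]
  let f : n → ℝ := fun i => if d i = 0 then 1 else √(d i)
  have hf (i : n) : f i ≠ 0 := by
    by_cases h : d i = 0
    · simp [f, h]
    · simpa [f, h] using (Real.sqrt_pos.mpr ((hd i).lt_of_ne' h)).ne'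
  let q : n → ℝ := fun i => if d i = 0 then 0 else 1
  refine ⟨U * diagonal f⁻¹, diagonal f * Uᴴ, diagonal q, ?_, ?_, ?_, ?_⟩
  · have : diagonal f⁻¹ * diagonal f = 1 := by
      rw [diagonal_mul_diagonal, ← diagonal_one]
      congr 1; ext i; simp [hf i]
    rw [mul_assoc, ← mul_assoc (diagonal f⁻¹), this, one_mul, hUU']
  · have : (U * diagonal f⁻¹)ᴴ * B * (U * diagonal f⁻¹) =
        diagonal f⁻¹ * (Uᴴ * B * U) * diagonal f⁻¹ := by
      simp [mul_assoc]
    rw [this, hBd, diagonal_mul_diagonal, diagonal_mul_diagonal]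
    congr 1; ext i
    by_cases h : d i = 0
    · simp [f, q, h]
    · have h1 := hf i
      have h2 : f i * f i = d i := by simp [f, h, Real.mul_self_sqrt (hd i)]
      have h3 : q i = 1 := if_neg h
      rw [h3, Pi.inv_apply, ← h2]
      field_simp
  · simp
  · rw [diagonal_mul_diagonal]
    congr 1; ext i; simp [q]

theorem exists_sparsify [Fintype ι] {B : ι → Matrix n n ℝ} (hB : ∀ i, (B i).PosSemidef)
    {ε : ℝ} (hε : 0 < ε) (hε1 : ε < 1) :
    ∃ y : ι → ℝ, (∀ i, 0 ≤ y i) ∧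
      (#{i | y i ≠ 0} : ℝ) ≤ 49 * Fintype.card n / ε ^ 2 ∧
      (∑ i, y i • B i - ∑ i, B i).PosSemidef ∧
      ((1 + ε) • ∑ i, B i - ∑ i, y i • B i).PosSemidef := by
  obtain ⟨V, W, Q, hVW, hVB, hQ, hQQ⟩ :=
    (posSemidef_sum Finset.univ fun i _ => hB i).exists_congruent_projection
  obtain ⟨y, hy, hcard, h1, h2⟩ := exists_sparsify_of_sum_eq_projection
    (C := fun i => Vᴴ * B i * V) (fun i => (hB i).conjTranspose_mul_mul_same V) hQ hQQ
    (by rw [← hVB, Finset.mul_sum, Finset.sum_mul]) hε hε1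
  have hconj : ∑ i, y i • (Vᴴ * B i * V) = Vᴴ * (∑ i, y i • B i) * V := by
    simp [Finset.mul_sum, Finset.sum_mul]
  have hback (X : Matrix n n ℝ) : Wᴴ * (Vᴴ * X * V) * W = X := by
    have : Wᴴ * (Vᴴ * X * V) * W = (V * W)ᴴ * X * (V * W) := by
      simp [mul_assoc]
    rw [this, hVW]; simp
  refine ⟨y, hy, hcard, ?_, ?_⟩
  · have := h1.conjTranspose_mul_mul_same W
    rwa [hconj, ← hVB, ← sub_mul, ← mul_sub, hback] at this
  · have := h2.conjTranspose_mul_mul_same W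
    rwa [hconj, ← hVB, ← smul_mul_assoc, ← mul_smul_comm, ← sub_mul, ← mul_sub, hback] at this

end Matrix

/-- **Sparsifying sums of PSD matrices (Theorem 1 / BSS extension).**
There is a universal constant `C` such that for all symmetric PSD matrices
`B₁, …, Bₘ` and every `ε ∈ (0,1)` there is `y ≥ 0` with at most `C·n/ε²`
nonzero entries and `B ⪯ Σ yᵢ Bᵢ ⪯ (1+ε)·B` where `B = Σ Bᵢ`. -/
theorem sparsify_psd_sum :
    ∃ C : ℝ, 0 < C ∧
      ∀ (n m : ℕ) (B : Fin m → Matrix (Fin n) (Fin n) ℝ),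
        (∀ i, (B i).PosSemidef) →
        ∀ ε : ℝ, ε ∈ Set.Ioo (0 : ℝ) 1 →
          ∃ y : Fin m → ℝ,
            (∀ i, 0 ≤ y i) ∧
            ((univ.filter fun i => y i ≠ 0).card : ℝ) ≤ C * n / ε ^ 2 ∧
            ((∑ i, y i • B i) - (∑ i, B i)).PosSemidef ∧
            ((1 + ε) • (∑ i, B i) - (∑ i, y i • B i)).PosSemidef := by
  refine ⟨49, by norm_num, fun n m B hB ε hε => ?_⟩
  simpa only [Fintype.card_fin] using Matrix.exists_sparsify hB hε.1 hε.2
end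

section
/- Let G = (V,E) be a finite graph on n vertices, let w : E → ℝ≥0 be a weight function, and let c_1, ..., c_k : E → ℝ≥0 be cost functions. Then there is a universal constant C such that for every ε ∈ (0,1) there exists a weight function w_H : E → ℝ≥0 whose support has at most C·(n+k)/ε² edges, satisfying L_G(w) ⪯ L_G(w_H) ⪯ (1+ε)·L_G(w) and, for every i ∈ {1,...,k}, Σ_{e∈E} w_e c_{i,e} ≤ Σ_{e∈E} w_{H,e} c_{i,e} ≤ (1+ε)·Σ_{e∈E} w_e c_{i,e}. -/
open Finset

/-- The rank-one edge matrix `(e_i - e_j)(e_i - e_j)ᵀ`. -/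
noncomputable def edgeMatrix {n : ℕ} (i j : Fin n) : Matrix (Fin n) (Fin n) ℝ :=
  Matrix.vecMulVec (Pi.single i 1 - Pi.single j 1) (Pi.single i 1 - Pi.single j 1)

/-- The weighted Laplacian of a graph on `Fin n` whose edges are indexed by the
finite type `E` with endpoint map `ends`. -/
noncomputable def weightedLaplacian {n : ℕ} {E : Type} [Fintype E]
    (ends : E → Fin n × Fin n) (w : E → ℝ) : Matrix (Fin n) (Fin n) ℝ :=
  ∑ e, w e • edgeMatrix (ends e).1 (ends e).2

namespace Matrix

variable {n : Type*} [Fintype n] [DecidableEq n]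

/-- A real symmetric matrix is orthogonally diagonalizable. -/
theorem IsHermitian.exists_orthogonal_diagonal {A : Matrix n n ℝ} (hA : A.IsHermitian) :
    ∃ (U : Matrix n n ℝ) (d : n → ℝ), Uᵀ * U = 1 ∧ U * Uᵀ = 1 ∧ A = U * diagonal d * Uᵀ := by
  refine ⟨hA.eigenvectorUnitary, hA.eigenvalues, ?_, ?_, ?_⟩
  · simpa [star_eq_conjTranspose] using Unitary.coe_star_mul_self hA.eigenvectorUnitary
  · simpa [star_eq_conjTranspose] using Unitary.coe_mul_star_self hA.eigenvectorUnitary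
  · have h := hA.spectral_theorem
    rw [Unitary.conjStarAlgAut_apply, star_eq_conjTranspose,
      conjTranspose_eq_transpose_of_trivial] at h
    exact h

omit [DecidableEq n] in
theorem PosSemidef.transpose_mul_mul_same {m : Type*} [Fintype m] {A : Matrix n n ℝ}
    (hA : A.PosSemidef) (B : Matrix n m ℝ) : (Bᵀ * A * B).PosSemidef := by
  simpa using hA.conjTranspose_mul_mul_same B

theorem PosDef.transpose_mul_mul_same {A B C : Matrix n n ℝ} (hA : A.PosDef) (hC : C * B = 1) :
    (Bᵀ * A * B).PosDef := by
  have hinj : Function.Injective B.mulVec := fun x y hxy => by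
    simpa [hC] using congrArg C.mulVec hxy
  simpa using hA.conjTranspose_mul_mul_same hinj

theorem trace_mul_diagonal_mul_transpose (S : Matrix n n ℝ) (g : n → ℝ) :
    (S * diagonal g * Sᵀ).trace = ∑ i, (Sᵀ * S) i i * g i := by
  rw [trace_mul_comm, ← Matrix.mul_assoc]
  simp [trace]

/-- A positive diagonal matrix and a positive semidefinite matrix are simultaneously
diagonalizable by a congruence. -/
theorem PosSemidef.exists_congr_diagonal {X : Matrix n n ℝ} (hX : X.PosSemidef) {d : n → ℝ}
    (hd : ∀ i, 0 < d i) :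
    ∃ (S W : Matrix n n ℝ) (x : n → ℝ), (∀ i, 0 ≤ x i) ∧ S * W = 1 ∧ W * S = 1 ∧
      diagonal d = Wᵀ * W ∧ X = Wᵀ * diagonal x * W ∧ S * Sᵀ = diagonal (fun i => (d i)⁻¹) ∧
      ∑ i, x i = ∑ i, X i i / d i ∧
      (S * diagonal x * Sᵀ).trace = ∑ i, X i i / d i ^ 2 := by
  set r : n → ℝ := fun i => (√(d i))⁻¹ with hr
  set s : n → ℝ := fun i => √(d i) with hs
  have hss : ∀ i, s i * s i = d i := fun i => Real.mul_self_sqrt (hd i).le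
  have hs0 : ∀ i, s i ≠ 0 := fun i => (Real.sqrt_pos.2 (hd i)).ne'
  have hrs : ∀ i, r i * s i = 1 := fun i => inv_mul_cancel₀ (hs0 i)
  have hrs' : diagonal r * diagonal s = (1 : Matrix n n ℝ) := by
    simp [diagonal_mul_diagonal, hrs]
  have hsr' : diagonal s * diagonal r = (1 : Matrix n n ℝ) := by
    simp [diagonal_mul_diagonal, mul_comm (s _), hrs]
  have hrr : ∀ i, r i * r i = (d i)⁻¹ := fun i => by
    rw [← hss i, mul_inv]
  have hYpsd : (diagonal r * X * diagonal r).PosSemidef := by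
    simpa using hX.transpose_mul_mul_same (diagonal r)
  obtain ⟨V, x, h1, h2, h3⟩ := hYpsd.isHermitian.exists_orthogonal_diagonal
  have hdx : diagonal x = Vᵀ * (diagonal r * X * diagonal r) * V := by
    rw [h3]
    simp only [Matrix.mul_assoc, h1]
    simp [← Matrix.mul_assoc, h1]
  have hXe : X = (Vᵀ * diagonal s)ᵀ * diagonal x * (Vᵀ * diagonal s) := by
    calc X = (diagonal s * diagonal r) * X * (diagonal r * diagonal s) := by simp [hrs', hsr']
      _ = diagonal s * (diagonal r * X * diagonal r) * diagonal s := by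
        simp only [Matrix.mul_assoc]
      _ = _ := by rw [h3]; simp [Matrix.mul_assoc]
  have hSx : (diagonal r * V) * diagonal x * (diagonal r * V)ᵀ =
      diagonal r * (diagonal r * X * diagonal r) * diagonal r := by
    rw [h3]; simp [Matrix.mul_assoc]
  refine ⟨diagonal r * V, Vᵀ * diagonal s, x, ?_, ?_, ?_, ?_, hXe, ?_, ?_, ?_⟩
  · have h4 : (diagonal x).PosSemidef := by
      rw [hdx]; exact hYpsd.transpose_mul_mul_same V
    intro i
    simpa using h4.diag_nonneg (i := i)
  · rw [Matrix.mul_assoc, ← Matrix.mul_assoc V, h2, Matrix.one_mul, hrs']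
  · rw [Matrix.mul_assoc, ← Matrix.mul_assoc (diagonal s), hsr', Matrix.one_mul, h1]
  · simp only [transpose_mul, diagonal_transpose, transpose_transpose]
    rw [Matrix.mul_assoc, ← Matrix.mul_assoc V, h2, Matrix.one_mul, diagonal_mul_diagonal]
    simp [hss]
  · simp only [transpose_mul, diagonal_transpose]
    rw [Matrix.mul_assoc, ← Matrix.mul_assoc V, h2, Matrix.one_mul, diagonal_mul_diagonal]
    simp [hrr]
  · have h4 : (diagonal x).trace = (diagonal r * X * diagonal r).trace := by
      rw [hdx, trace_mul_comm, ← Matrix.mul_assoc, h2, Matrix.one_mul]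
    rw [trace_diagonal] at h4
    rw [h4]
    simp only [trace, diag_apply, mul_diagonal, diagonal_mul]
    refine sum_congr rfl fun i _ => ?_
    rw [div_eq_mul_inv, ← hrr]; ring
  · rw [hSx]
    simp only [trace, diag_apply, mul_diagonal, diagonal_mul]
    refine sum_congr rfl fun i _ => ?_
    rw [div_eq_mul_inv, ← inv_pow, ← hrr]; ring

/-- Perturbation of the barrier `trace D⁻¹` under adding a multiple of a positive semidefinite
matrix of arbitrary rank. -/
theorem PosSemidef.trace_inv_diagonal_add_smul_le {X : Matrix n n ℝ} (hX : X.PosSemidef)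
    {d : n → ℝ} (hd : ∀ i, 0 < d i) {σ : ℝ} (hσ : 0 < 1 + σ * ∑ i, X i i / d i) :
    (diagonal d + σ • X).PosDef ∧
      (diagonal d + σ • X)⁻¹.trace ≤
        ∑ i, (d i)⁻¹ - σ * (∑ i, X i i / d i ^ 2) / (1 + σ * ∑ i, X i i / d i) := by
  obtain ⟨S, W, x, hx, hSW, hWS, hdW, hXW, hSS, hsum, htr⟩ := hX.exists_congr_diagonal hd
  rw [← hsum] at hσ ⊢
  rw [← htr]
  set τ := ∑ i, x i
  have hxτ : ∀ i, x i ≤ τ := fun i => single_le_sum (fun j _ => hx j) (mem_univ i)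
  have hpos : ∀ i, 0 < 1 + σ * x i := fun i => by
    rcases le_total 0 σ with h | h
    · have := mul_nonneg h (hx i); linarith
    · have := mul_le_mul_of_nonpos_left (hxτ i) h; linarith
  have hM : diagonal d + σ • X = Wᵀ * diagonal (fun i => 1 + σ * x i) * W := by
    have h1 : diagonal (fun i => 1 + σ * x i) = 1 + σ • diagonal x := by
      rw [← diagonal_one, ← diagonal_smul, diagonal_add]; rfl
    rw [h1, hdW]
    conv_lhs => rw [hXW]
    simp [Matrix.mul_add, Matrix.add_mul]
  have hinv : (diagonal d + σ • X)⁻¹ = S * diagonal (fun i => (1 + σ * x i)⁻¹) * Sᵀ := by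
    refine inv_eq_right_inv ?_
    rw [hM]
    calc Wᵀ * diagonal (fun i => 1 + σ * x i) * W *
          (S * diagonal (fun i => (1 + σ * x i)⁻¹) * Sᵀ)
        = Wᵀ * (diagonal (fun i => 1 + σ * x i) * (W * S) *
          diagonal (fun i => (1 + σ * x i)⁻¹)) * Sᵀ := by simp only [Matrix.mul_assoc]
      _ = Wᵀ * Sᵀ := by
        simp [hWS, diagonal_mul_diagonal, fun i => (hpos i).ne']
      _ = 1 := by rw [← transpose_mul, hSW, transpose_one]
  refine ⟨?_, ?_⟩
  · rw [hM]
    exact (PosDef.diagonal hpos).transpose_mul_mul_same hSW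
  · have hSSnn : ∀ i, 0 ≤ (Sᵀ * S) i i := fun i => by
      have h := (PosSemidef.one (n := n) (R := ℝ)).transpose_mul_mul_same S
      rw [Matrix.mul_one] at h
      exact h.diag_nonneg
    have h0 : ∑ i, (d i)⁻¹ = ∑ i, (Sᵀ * S) i i := by
      have h := congrArg trace hSS
      rw [trace_diagonal, trace_mul_comm] at h
      rw [← h]; rfl
    rw [hinv, h0, trace_mul_diagonal_mul_transpose, trace_mul_diagonal_mul_transpose, mul_sum,
      sum_div, ← sum_sub_distrib]
    refine sum_le_sum fun i _ => ?_
    have h1 : (1 + σ * x i)⁻¹ ≤ 1 - σ * x i / (1 + σ * τ) := by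
      rw [← one_div, div_le_iff₀ (hpos i)]
      have h2 : 0 ≤ σ * σ * x i * (τ - x i) / (1 + σ * τ) :=
        div_nonneg (mul_nonneg (mul_nonneg (mul_self_nonneg σ) (hx i))
          (sub_nonneg.2 (hxτ i))) hσ.le
      have h3 : (1 - σ * x i / (1 + σ * τ)) * (1 + σ * x i) =
          1 + σ * σ * x i * (τ - x i) / (1 + σ * τ) := by
        field_simp
        ring
      linarith
    calc (Sᵀ * S) i i * (1 + σ * x i)⁻¹ ≤ (Sᵀ * S) i i * (1 - σ * x i / (1 + σ * τ)) :=
          mul_le_mul_of_nonneg_left h1 (hSSnn i)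
      _ = _ := by ring

/-- The two-sided barrier invariant: `l • 1 ≺ A ≺ u • 1`, with both inverse traces at most `a`. -/
def IsBarrier (a l u : ℝ) (A : Matrix n n ℝ) : Prop :=
  ((diagonal fun _ => u) - A).PosDef ∧ (A - diagonal fun _ => l).PosDef ∧
    ((diagonal fun _ => u) - A)⁻¹.trace ≤ a ∧ (A - diagonal fun _ => l)⁻¹.trace ≤ a

theorem PosDef.transpose_mul_mul_orthogonal {A U : Matrix n n ℝ} (hA : A.PosDef)
    (h1 : U * Uᵀ = 1) (h2 : Uᵀ * U = 1) :
    (U * A * Uᵀ).PosDef ∧ (U * A * Uᵀ)⁻¹.trace = A⁻¹.trace := by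
  refine ⟨by simpa using hA.transpose_mul_mul_same (B := Uᵀ) h1, ?_⟩
  have hdet : IsUnit A.det := (isUnit_iff_isUnit_det A).1 hA.isUnit
  have hinv : (U * A * Uᵀ)⁻¹ = U * A⁻¹ * Uᵀ := by
    refine inv_eq_right_inv ?_
    calc U * A * Uᵀ * (U * A⁻¹ * Uᵀ) = U * (A * (Uᵀ * U) * A⁻¹) * Uᵀ := by
          simp only [Matrix.mul_assoc]
      _ = 1 := by rw [h2, Matrix.mul_one, mul_nonsing_inv _ hdet, Matrix.mul_one, h1]
  rw [hinv, trace_mul_comm, ← Matrix.mul_assoc, h2, Matrix.one_mul]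

theorem conj_orthogonal_diagonal_const {U : Matrix n n ℝ} (h1 : U * Uᵀ = 1) (c : ℝ) :
    U * (diagonal fun _ => c) * Uᵀ = diagonal fun _ => c := by
  have h : (diagonal fun _ => c : Matrix n n ℝ) = c • 1 := by
    rw [smul_one_eq_diagonal]
  rw [h]; simp [h1]

theorem IsBarrier.conj_orthogonal {a l u : ℝ} {A U : Matrix n n ℝ} (hA : IsBarrier a l u A)
    (h1 : U * Uᵀ = 1) (h2 : Uᵀ * U = 1) : IsBarrier a l u (U * A * Uᵀ) := by
  obtain ⟨hu, hl, hu', hl'⟩ := hA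
  have e1 : (diagonal fun _ => u) - U * A * Uᵀ = U * ((diagonal fun _ => u) - A) * Uᵀ := by
    rw [Matrix.mul_sub, Matrix.sub_mul, conj_orthogonal_diagonal_const h1]
  have e2 : U * A * Uᵀ - (diagonal fun _ => l) = U * (A - diagonal fun _ => l) * Uᵀ := by
    rw [Matrix.mul_sub, Matrix.sub_mul, conj_orthogonal_diagonal_const h1]
  unfold IsBarrier
  rw [e1, e2, (hu.transpose_mul_mul_orthogonal h1 h2).2, (hl.transpose_mul_mul_orthogonal h1 h2).2]
  exact ⟨(hu.transpose_mul_mul_orthogonal h1 h2).1, (hl.transpose_mul_mul_orthogonal h1 h2).1,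
    hu', hl'⟩

theorem isBarrier_diagonal_iff {a l u : ℝ} {v : n → ℝ} :
    IsBarrier a l u (diagonal v) ↔ (∀ i, v i < u) ∧ (∀ i, l < v i) ∧
      ∑ i, (u - v i)⁻¹ ≤ a ∧ ∑ i, (v i - l)⁻¹ ≤ a := by
  unfold IsBarrier
  rw [diagonal_sub, diagonal_sub, posDef_diagonal_iff, posDef_diagonal_iff]
  simp only [sub_pos]
  refine and_congr_right fun h1 => and_congr_right fun h2 => ?_
  have inv_diag : ∀ d : n → ℝ, (∀ i, d i ≠ 0) →
      (diagonal d)⁻¹ = diagonal fun i => (d i)⁻¹ := fun d hd => by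
    refine inv_eq_right_inv ?_
    simp [diagonal_mul_diagonal, hd]
  rw [inv_diag _ fun i => (sub_pos.2 (h1 i)).ne', inv_diag _ fun i => (sub_pos.2 (h2 i)).ne',
    trace_diagonal, trace_diagonal]

omit [DecidableEq n] in
theorem mul_sum_inv_sq_le {m : n → ℝ} (hm : ∀ i, 0 < m i) {δ : ℝ} (hδ : 0 < δ) :
    δ * ∑ i, ((m i + δ) ^ 2)⁻¹ ≤ ∑ i, (m i)⁻¹ - ∑ i, (m i + δ)⁻¹ := by
  rw [mul_sum, ← sum_sub_distrib]
  refine sum_le_sum fun i _ => ?_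
  have h := hm i
  have h2 : (m i)⁻¹ - (m i + δ)⁻¹ - δ * ((m i + δ) ^ 2)⁻¹ = δ ^ 2 / (m i * (m i + δ) ^ 2) := by
    field_simp
    ring
  have h3 : 0 ≤ δ ^ 2 / (m i * (m i + δ) ^ 2) := by positivity
  linarith

omit [DecidableEq n] in
theorem le_sum_inv_sq {κ : n → ℝ} (hκ : ∀ i, 0 < κ i) (h1 : ∑ i, (κ i + 1)⁻¹ ≤ 1) :
    (1 + (∑ i, (κ i)⁻¹ - ∑ i, (κ i + 1)⁻¹)) * (∑ i, (κ i)⁻¹ - ∑ i, (κ i + 1)⁻¹) ≤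
      ∑ i, (κ i ^ 2)⁻¹ := by
  have hD : ∑ i, (κ i)⁻¹ - ∑ i, (κ i + 1)⁻¹ = ∑ i, (κ i * (κ i + 1))⁻¹ := by
    rw [← sum_sub_distrib]
    refine sum_congr rfl fun i _ => ?_
    have h := hκ i
    field_simp
    ring
  have hQ : ∑ i, (κ i ^ 2)⁻¹ =
      ∑ i, (κ i * (κ i + 1))⁻¹ + ∑ i, (κ i ^ 2 * (κ i + 1))⁻¹ := by
    rw [← sum_add_distrib]
    refine sum_congr rfl fun i _ => ?_
    have h := hκ i
    field_simp
  have hnn : ∀ i ∈ univ, 0 ≤ (κ i + 1)⁻¹ := fun i _ => by have := hκ i; positivity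
  have hnn' : ∀ i ∈ univ, 0 ≤ (κ i ^ 2 * (κ i + 1))⁻¹ := fun i _ => by have := hκ i; positivity
  have hcs : (∑ i, (κ i * (κ i + 1))⁻¹) ^ 2 ≤
      (∑ i, (κ i + 1)⁻¹) * ∑ i, (κ i ^ 2 * (κ i + 1))⁻¹ := by
    refine sum_sq_le_sum_mul_sum_of_sq_le_mul _ hnn hnn' fun i _ => le_of_eq ?_
    have h := hκ i
    field_simp
  have h2 := mul_le_mul_of_nonneg_right h1 (sum_nonneg hnn')
  rw [hD, hQ]
  nlinarith

theorem sum_sum_diag_mul {E : Type*} [Fintype E] {X : E → Matrix n n ℝ} (hX1 : ∑ e, X e = 1)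
    (g : n → ℝ) : ∑ e, ∑ i, X e i i * g i = ∑ i, g i := by
  rw [sum_comm]
  refine sum_congr rfl fun i _ => ?_
  rw [← sum_mul, ← Matrix.sum_apply, hX1]
  simp

theorem IsBarrier.exists_step_diagonal [Nonempty n] {E : Type*} [Fintype E]
    {X : E → Matrix n n ℝ} (hX : ∀ e, (X e).PosSemidef) (hX1 : ∑ e, X e = 1)
    {a δ l u : ℝ} (hδ : 0 < δ) (haδ : δ⁻¹ + 2 * a < 1) {v : n → ℝ}
    (h : IsBarrier a l u (diagonal v)) :
    ∃ e, ∃ t : ℝ, 0 ≤ t ∧ IsBarrier a (l + 1) (u + δ) (diagonal v + t • X e) := by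
  obtain ⟨hu, hl, hua, hla⟩ := isBarrier_diagonal_iff.1 h
  have ha0 : 0 < a := lt_of_lt_of_le
    (sum_pos (fun i _ => inv_pos.2 (sub_pos.2 (hu i))) univ_nonempty) hua
  have hδ' : 0 < δ⁻¹ := inv_pos.2 hδ
  have ha1 : a < 1 := by linarith
  set m : n → ℝ := fun i => u - v i with hmdef
  have hm : ∀ i, 0 < m i := fun i => sub_pos.2 (hu i)
  set κ : n → ℝ := fun i => v i - l - 1 with hκdef
  have hκ1 : ∀ i, κ i + 1 = v i - l := fun i => by simp [hκdef]
  have hκ : ∀ i, 0 < κ i := fun i => by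
    have h1 : (v i - l)⁻¹ ≤ a := le_trans
      (single_le_sum (f := fun i => (v i - l)⁻¹)
        (fun j _ => (inv_pos.2 (sub_pos.2 (hl j))).le) (mem_univ i)) hla
    have h2 : 1 < v i - l := by
      by_contra! h3
      have := (one_le_inv₀ (sub_pos.2 (hl i))).2 h3
      linarith
    simp only [hκdef]; linarith
  have hmδ : ∀ i, 0 < m i + δ := fun i => add_pos (hm i) hδ
  simp only [← hκ1] at hla
  set Φu := ∑ i, (m i)⁻¹ with hΦu
  set Φu' := ∑ i, (m i + δ)⁻¹ with hΦu'
  set Φl := ∑ i, (κ i + 1)⁻¹ with hΦl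
  set Φl' := ∑ i, (κ i)⁻¹ with hΦl'
  have hΔu : 0 < Φu - Φu' := by
    rw [hΦu, hΦu', ← sum_sub_distrib]
    exact sum_pos (fun i _ => sub_pos.2 (inv_strictAnti₀ (hm i) (by linarith))) univ_nonempty
  have hΔl : 0 < Φl' - Φl := by
    rw [hΦl, hΦl', ← sum_sub_distrib]
    exact sum_pos (fun i _ => sub_pos.2 (inv_strictAnti₀ (hκ i) (by linarith))) univ_nonempty
  set P : E → ℝ := fun e => ∑ i, X e i i / (m i + δ) with hP
  set Q : E → ℝ := fun e => ∑ i, X e i i / (m i + δ) ^ 2 with hQ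
  set P' : E → ℝ := fun e => ∑ i, X e i i / κ i with hP'
  set Q' : E → ℝ := fun e => ∑ i, X e i i / κ i ^ 2 with hQ'
  have hsP : ∑ e, P e = Φu' := by
    simp only [hP, div_eq_mul_inv]; exact sum_sum_diag_mul hX1 _
  have hsQ : ∑ e, Q e = ∑ i, ((m i + δ) ^ 2)⁻¹ := by
    simp only [hQ, div_eq_mul_inv]; exact sum_sum_diag_mul hX1 _
  have hsP' : ∑ e, P' e = Φl' := by
    simp only [hP', div_eq_mul_inv]; exact sum_sum_diag_mul hX1 _
  have hsQ' : ∑ e, Q' e = ∑ i, (κ i ^ 2)⁻¹ := by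
    simp only [hQ', div_eq_mul_inv]; exact sum_sum_diag_mul hX1 _
  have hP0 : ∀ e, 0 ≤ P e := fun e =>
    sum_nonneg fun i _ => div_nonneg (hX e).diag_nonneg (hmδ i).le
  have hQ0 : ∀ e, 0 ≤ Q e := fun e =>
    sum_nonneg fun i _ => div_nonneg (hX e).diag_nonneg (sq_nonneg _)
  have hP'0 : ∀ e, 0 ≤ P' e := fun e =>
    sum_nonneg fun i _ => div_nonneg (hX e).diag_nonneg (hκ i).le
  have hup : ∑ e, (Q e / (Φu - Φu') + P e) ≤ δ⁻¹ + a := by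
    rw [sum_add_distrib, ← sum_div, hsP, hsQ]
    have h1 := mul_sum_inv_sq_le hm hδ
    have h2 : (∑ i, ((m i + δ) ^ 2)⁻¹) / (Φu - Φu') ≤ δ⁻¹ := by
      rw [div_le_iff₀ hΔu, ← div_eq_inv_mul, le_div_iff₀ hδ, mul_comm]
      exact h1
    linarith
  have hlow : 1 - a ≤ ∑ e, (Q' e / (Φl' - Φl) - P' e) := by
    rw [sum_sub_distrib, ← sum_div, hsP', hsQ']
    have h1 := (le_div_iff₀ hΔl).2 (le_sum_inv_sq hκ (hla.trans ha1.le))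
    linarith
  obtain ⟨e, -, he⟩ := exists_lt_of_sum_lt
    (lt_of_le_of_lt hup (lt_of_lt_of_le (by linarith : δ⁻¹ + a < 1 - a) hlow))
  set L := Q' e / (Φl' - Φl) - P' e with hL
  have hU0 : 0 ≤ Q e / (Φu - Φu') := div_nonneg (hQ0 e) hΔu.le
  have hLpos : 0 < L := by have := hP0 e; linarith
  have ht : 0 < L⁻¹ := inv_pos.2 hLpos
  have hU1 : L⁻¹ * (Q e / (Φu - Φu')) + L⁻¹ * P e < 1 := by
    rw [← mul_add, ← div_eq_inv_mul, div_lt_one hLpos]; exact he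
  have hσu : 0 < 1 + -L⁻¹ * P e := by
    have := mul_nonneg ht.le hU0; linarith
  have hσl : 0 < 1 + L⁻¹ * P' e := by
    have := mul_nonneg ht.le (hP'0 e); linarith
  obtain ⟨hu1, hu2⟩ := (hX e).trace_inv_diagonal_add_smul_le hmδ hσu
  obtain ⟨hl1, hl2⟩ := (hX e).trace_inv_diagonal_add_smul_le hκ hσl
  have e1 : (diagonal fun _ => u + δ) - (diagonal v + L⁻¹ • X e) =
      diagonal (fun i => m i + δ) + -L⁻¹ • X e := by
    rw [neg_smul, ← sub_sub, diagonal_sub, ← sub_eq_add_neg]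
    congr 2; funext i; simp only [hmdef]; ring
  have e2 : diagonal v + L⁻¹ • X e - (diagonal fun _ => l + 1) =
      diagonal κ + L⁻¹ • X e := by
    rw [add_sub_right_comm, diagonal_sub]
    congr 2; funext i; simp only [hκdef]; ring
  refine ⟨e, L⁻¹, ht.le, ?_⟩
  unfold IsBarrier
  rw [e1, e2]
  refine ⟨hu1, hl1, hu2.trans (le_trans ?_ hua), hl2.trans (le_trans ?_ hla)⟩
  · have h1 : L⁻¹ * Q e / (1 + -L⁻¹ * P e) ≤ Φu - Φu' := by
      rw [div_le_iff₀ hσu]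
      have h2 : L⁻¹ * Q e = (L⁻¹ * (Q e / (Φu - Φu'))) * (Φu - Φu') := by
        field_simp
      rw [h2, mul_comm (Φu - Φu')]
      exact mul_le_mul_of_nonneg_right (by linarith) hΔu.le
    have h2 : -L⁻¹ * Q e / (1 + -L⁻¹ * P e) = -(L⁻¹ * Q e / (1 + -L⁻¹ * P e)) := by ring
    change Φu' - -L⁻¹ * Q e / (1 + -L⁻¹ * P e) ≤ Φu
    linarith
  · have h1 : Φl' - Φl ≤ L⁻¹ * Q' e / (1 + L⁻¹ * P' e) := by
      rw [le_div_iff₀ hσl]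
      have h2 : L⁻¹ * Q' e = (L⁻¹ * (L + P' e)) * (Φl' - Φl) := by
        rw [hL]; field_simp; ring
      rw [h2, mul_add L⁻¹, inv_mul_cancel₀ hLpos.ne', mul_comm]
    change Φl' - L⁻¹ * Q' e / (1 + L⁻¹ * P' e) ≤ Φl
    linarith

theorem IsBarrier.exists_step [Nonempty n] {E : Type*} [Fintype E]
    {X : E → Matrix n n ℝ} (hX : ∀ e, (X e).PosSemidef) (hX1 : ∑ e, X e = 1)
    {a δ l u : ℝ} (hδ : 0 < δ) (haδ : δ⁻¹ + 2 * a < 1) {A : Matrix n n ℝ}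
    (h : IsBarrier a l u A) :
    ∃ e, ∃ t : ℝ, 0 ≤ t ∧ IsBarrier a (l + 1) (u + δ) (A + t • X e) := by
  have hA : A.IsHermitian := by
    have := h.2.1.isHermitian.add (isHermitian_diagonal fun _ => l)
    simpa using this
  obtain ⟨U, v, h1, h2, rfl⟩ := hA.exists_orthogonal_diagonal
  have hv : Uᵀ * (U * diagonal v * Uᵀ) * Uᵀᵀ = diagonal v := by
    simp [Matrix.mul_assoc, h1]
    simp [← Matrix.mul_assoc, h1]
  have h' := h.conj_orthogonal (U := Uᵀ) (by simpa using h1) (by simpa using h2)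
  rw [hv] at h'
  have hX1' : ∑ e, Uᵀ * X e * U = 1 := by
    rw [← sum_mul, ← mul_sum, hX1, Matrix.mul_one, h1]
  obtain ⟨e, t, ht, hb⟩ :=
    h'.exists_step_diagonal (fun e => (hX e).transpose_mul_mul_same U) hX1' hδ haδ
  refine ⟨e, t, ht, ?_⟩
  have hb' := hb.conj_orthogonal h2 h1
  have : U * (diagonal v + t • (Uᵀ * X e * U)) * Uᵀ = U * diagonal v * Uᵀ + t • X e := by
    rw [Matrix.mul_add, Matrix.add_mul]
    congr 1
    calc U * t • (Uᵀ * X e * U) * Uᵀ = t • ((U * Uᵀ) * X e * (U * Uᵀ)) := by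
          simp [Matrix.mul_assoc]
      _ = _ := by simp [h2]
  rwa [this] at hb'

theorem exists_isBarrier_sum [Nonempty n] {E : Type*} [Fintype E] [DecidableEq E]
    {X : E → Matrix n n ℝ} (hX : ∀ e, (X e).PosSemidef) (hX1 : ∑ e, X e = 1)
    {a δ : ℝ} (ha : 0 < a) (hδ : 0 < δ) (haδ : δ⁻¹ + 2 * a < 1) (T : ℕ) :
    ∃ y : E → ℝ, (∀ e, 0 ≤ y e) ∧ #{e | y e ≠ 0} ≤ T ∧
      IsBarrier a (-(Fintype.card n / a) + T) (Fintype.card n / a + T * δ) (∑ e, y e • X e) := by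
  induction T with
  | zero =>
    refine ⟨0, by simp, by simp, ?_⟩
    have hN : (0 : ℝ) < Fintype.card n := by exact_mod_cast Fintype.card_pos
    have h0 : (∑ e, (0 : E → ℝ) e • X e) = diagonal fun _ => (0 : ℝ) := by simp
    rw [h0, isBarrier_diagonal_iff]
    have : 0 < Fintype.card n / a := by positivity
    have h : (Fintype.card n : ℝ) * (a / Fintype.card n) ≤ a := by
      rw [mul_div_cancel₀ _ hN.ne']
    refine ⟨fun _ => by simpa using this, fun _ => by simpa using this, ?_, ?_⟩ <;> simpa using h
  | succ T ih =>
    obtain ⟨y, hy, hc, hb⟩ := ih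
    obtain ⟨e, t, ht, hb'⟩ := hb.exists_step hX hX1 hδ haδ
    refine ⟨y + Pi.single e t, fun f => add_nonneg (hy f) ?_, ?_, ?_⟩
    · rw [Pi.single_apply]; split_ifs <;> simp [ht]
    · have hsub : ({f | (y + Pi.single e t : E → ℝ) f ≠ 0} : Finset E) ⊆
          insert e ({f | y f ≠ 0} : Finset E) := by
        intro f hf
        by_cases hfe : f = e
        · simp [hfe]
        · simpa [hfe] using hf
      exact (card_le_card hsub).trans ((card_insert_le _ _).trans (Nat.succ_le_succ hc))
    · have hs : ∑ f, (y + Pi.single e t : E → ℝ) f • X f = ∑ f, y f • X f + t • X e := by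
        simp [add_smul, sum_add_distrib, Pi.single_apply, ite_smul]
      rw [hs]
      convert hb' using 1 <;> push_cast <;> ring

/-- Spectral sparsification of a decomposition of the identity into positive semidefinite
matrices of arbitrary rank. -/
theorem exists_sparse_sum_of_sum_eq_one {E : Type*} [Fintype E] [DecidableEq E]
    {X : E → Matrix n n ℝ} (hX : ∀ e, (X e).PosSemidef) (hX1 : ∑ e, X e = 1)
    {ε : ℝ} (hε : ε ∈ Set.Ioo (0 : ℝ) 1) :
    ∃ y : E → ℝ, (∀ e, 0 ≤ y e) ∧ (#{e | y e ≠ 0} : ℝ) ≤ 512 * Fintype.card n / ε ^ 2 ∧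
      (∑ e, y e • X e - 1).PosSemidef ∧ ((1 + ε) • 1 - ∑ e, y e • X e).PosSemidef := by
  obtain ⟨hε0, hε1⟩ := hε
  rcases isEmpty_or_nonempty n with hn | hn
  · refine ⟨0, by simp, by simp, ?_, ?_⟩
    · rw [Subsingleton.elim (_ - _ : Matrix n n ℝ) 0]; exact PosSemidef.zero
    · rw [Subsingleton.elim (_ - _ : Matrix n n ℝ) 0]; exact PosSemidef.zero
  have hN : (1 : ℝ) ≤ Fintype.card n := by exact_mod_cast Fintype.card_pos
  set N : ℝ := (Fintype.card n : ℝ) with hNdef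
  set a : ℝ := ε / 16 with hadef
  have ha : 0 < a := by positivity
  have ha1 : a < 1 / 16 := by rw [hadef]; linarith
  have hδ : 0 < 1 + 4 * a := by linarith
  have haδ : (1 + 4 * a)⁻¹ + 2 * a < 1 := by
    have h1 : (1 + 4 * a)⁻¹ < 1 - 2 * a := by
      rw [← one_div, div_lt_iff₀ hδ]; nlinarith
    linarith
  set T := ⌈N / a ^ 2⌉₊ with hTdef
  have hT1 : N / a ^ 2 ≤ T := Nat.le_ceil _
  have hT2 : (T : ℝ) < N / a ^ 2 + 1 := Nat.ceil_lt_add_one (by positivity)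
  have hNa : N / a ≤ a * T := by
    have h1 : N / a = a * (N / a ^ 2) := by field_simp
    rw [h1]; exact mul_le_mul_of_nonneg_left hT1 ha.le
  have hTpos : (0 : ℝ) < T := lt_of_lt_of_le (by positivity) hT1
  obtain ⟨y, hy, hc, hu, hl, -, -⟩ := exists_isBarrier_sum hX hX1 ha hδ haδ T
  rw [← hNdef] at hu hl
  set l := -(N / a) + T with hldef
  set u := N / a + T * (1 + 4 * a) with hudef
  have hlT : T * (1 - a) ≤ l := by rw [hldef]; linarith
  have hl0 : 0 < l := lt_of_lt_of_le (mul_pos hTpos (by linarith)) hlT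
  have hul : u ≤ (1 + ε) * l := by
    have h1 : u ≤ T * (1 + 5 * a) := by rw [hudef]; linarith
    have h2 : (1 + ε) * (T * (1 - a)) ≤ (1 + ε) * l :=
      mul_le_mul_of_nonneg_left hlT (by linarith)
    have h3 : ε = 16 * a := by rw [hadef]; ring
    have h4 : T * (1 + 5 * a) ≤ T * ((1 + ε) * (1 - a)) :=
      mul_le_mul_of_nonneg_left (by rw [h3]; nlinarith) hTpos.le
    linarith
  have hs : ∑ e, (l⁻¹ * y e) • X e = l⁻¹ • ∑ e, y e • X e := by
    rw [smul_sum]; simp only [mul_smul]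
  refine ⟨fun e => l⁻¹ * y e, fun e => mul_nonneg (inv_nonneg.2 hl0.le) (hy e), ?_, ?_, ?_⟩
  · have h1 : (#{e | l⁻¹ * y e ≠ 0} : ℝ) ≤ T := by
      simp only [ne_eq, mul_eq_zero, inv_eq_zero, hl0.ne', false_or]
      exact_mod_cast hc
    have h2 : (1 : ℝ) ≤ N / a ^ 2 := by
      rw [le_div_iff₀ (by positivity)]; nlinarith
    have h3 : 512 * N / ε ^ 2 = 2 * (N / a ^ 2) := by
      rw [hadef]; field_simp; norm_num
    rw [h3]; linarith
  · have h1 : l⁻¹ • ∑ e, y e • X e - 1 = l⁻¹ • (∑ e, y e • X e - diagonal fun _ => l) := by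
      rw [smul_sub, ← smul_one_eq_diagonal, smul_smul, inv_mul_cancel₀ hl0.ne', one_smul]
    rw [hs, h1]
    exact hl.posSemidef.smul (inv_nonneg.2 hl0.le)
  · have h1 : (1 + ε) • 1 - l⁻¹ • ∑ e, y e • X e =
        l⁻¹ • ((diagonal fun _ => u) - ∑ e, y e • X e) +
          diagonal fun _ => l⁻¹ * ((1 + ε) * l - u) := by
      rw [smul_sub, ← smul_one_eq_diagonal, ← smul_one_eq_diagonal, smul_smul]
      have h2 : l⁻¹ * ((1 + ε) * l - u) = (1 + ε) - l⁻¹ * u := by field_simp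
      rw [h2, sub_smul]; abel
    rw [hs, h1]
    exact (hu.posSemidef.smul (inv_nonneg.2 hl0.le)).add
      (PosSemidef.diagonal fun _ => mul_nonneg (inv_nonneg.2 hl0.le) (sub_nonneg.2 hul))

omit [DecidableEq n] in
theorem PosSemidef.mul_eq_zero_of_transpose_mul_mul_eq_zero {A R : Matrix n n ℝ}
    (hA : A.PosSemidef) (h : Rᵀ * A * R = 0) : A * R = 0 := by
  ext i j
  have h1 : star (R.col j) ⬝ᵥ A *ᵥ R.col j = 0 := by
    have h2 := congrFun (congrFun h j) j
    rw [Matrix.mul_assoc] at h2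
    simpa [mul_apply, dotProduct, mulVec] using h2
  have h3 := congrFun ((hA.dotProduct_mulVec_zero_iff _).1 h1) i
  simpa [mul_apply, mulVec, dotProduct] using h3

/-- Spectral sparsification of a sum of positive semidefinite matrices of arbitrary rank. -/
theorem exists_sparse_sum {E : Type*} [Fintype E] [DecidableEq E]
    {B : E → Matrix n n ℝ} (hB : ∀ e, (B e).PosSemidef)
    {ε : ℝ} (hε : ε ∈ Set.Ioo (0 : ℝ) 1) :
    ∃ y : E → ℝ, (∀ e, 0 ≤ y e) ∧ (#{e | y e ≠ 0} : ℝ) ≤ 512 * Fintype.card n / ε ^ 2 ∧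
      (∑ e, y e • B e - ∑ e, B e).PosSemidef ∧
      ((1 + ε) • ∑ e, B e - ∑ e, y e • B e).PosSemidef := by
  have hS : (∑ e, B e).PosSemidef := posSemidef_sum _ fun e _ => hB e
  obtain ⟨U, v, h1, h2, hU⟩ := hS.isHermitian.exists_orthogonal_diagonal
  have hv' : diagonal v = Uᵀ * (∑ e, B e) * U := by
    rw [hU]
    simp only [Matrix.mul_assoc, h1]
    simp [← Matrix.mul_assoc, h1]
  have hv : ∀ i, 0 ≤ v i := fun i => by
    have h3 : (diagonal v).PosSemidef := by rw [hv']; exact hS.transpose_mul_mul_same U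
    simpa using h3.diag_nonneg (i := i)
  set s : n → ℝ := fun i => √(v i) with hs
  have hss : ∀ i, s i * s i = v i := fun i => Real.mul_self_sqrt (hv i)
  set P : Matrix n n ℝ := U * diagonal fun i => (s i)⁻¹ with hP
  set Q : Matrix n n ℝ := diagonal s * Uᵀ with hQ
  have hPQ : P * Q = U * diagonal (fun i => (s i)⁻¹ * s i) * Uᵀ := by
    rw [hP, hQ, Matrix.mul_assoc, ← Matrix.mul_assoc (diagonal _), diagonal_mul_diagonal,
      Matrix.mul_assoc]
  have hQQ : Qᵀ * Q = ∑ e, B e := by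
    rw [hU, hQ, transpose_mul, transpose_transpose, diagonal_transpose, Matrix.mul_assoc,
      ← Matrix.mul_assoc (diagonal s), diagonal_mul_diagonal, Matrix.mul_assoc]
    simp only [hss]
  have hSR : (∑ e, B e) * (1 - P * Q) = 0 := by
    rw [Matrix.mul_sub, Matrix.mul_one, hPQ, hU]
    have h3 : U * diagonal v * Uᵀ * (U * diagonal (fun i => (s i)⁻¹ * s i) * Uᵀ) =
        U * (diagonal v * (Uᵀ * U) * diagonal (fun i => (s i)⁻¹ * s i)) * Uᵀ := by
      simp only [Matrix.mul_assoc]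
    rw [h3, h1, Matrix.mul_one, diagonal_mul_diagonal, sub_eq_zero]
    congr 3
    funext i
    rw [← hss i]
    by_cases h : s i = 0 <;> simp [h]
  have hBR : ∀ e, B e * (1 - P * Q) = 0 := fun e => by
    refine (hB e).mul_eq_zero_of_transpose_mul_mul_eq_zero ?_
    have hpsd : ∀ f, ((1 - P * Q)ᵀ * B f * (1 - P * Q)).PosSemidef := fun f =>
      (hB f).transpose_mul_mul_same _
    have h3 : ∑ f, ((1 - P * Q)ᵀ * B f * (1 - P * Q)).trace = 0 := by
      rw [← trace_sum, ← sum_mul, ← mul_sum, Matrix.mul_assoc, hSR, Matrix.mul_zero, trace_zero]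
    exact (hpsd e).trace_eq_zero_iff.1
      ((sum_eq_zero_iff_of_nonneg fun f _ => (hpsd f).trace_nonneg).1 h3 e (mem_univ e))
  have hBPQ : ∀ e, B e * (P * Q) = B e := fun e => by
    have h3 := hBR e
    rw [Matrix.mul_sub, Matrix.mul_one, sub_eq_zero] at h3
    exact h3.symm
  have hPQB : ∀ e, (P * Q)ᵀ * B e = B e := fun e => by
    have h3 := congrArg transpose (hBPQ e)
    have h4 : (B e)ᵀ = B e := by simpa using (hB e).isHermitian.eq
    rwa [transpose_mul, h4] at h3
  have hback : ∀ e, Qᵀ * (Pᵀ * B e * P) * Q = B e := fun e => by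
    calc Qᵀ * (Pᵀ * B e * P) * Q = (P * Q)ᵀ * B e * (P * Q) := by
          simp [Matrix.mul_assoc]
      _ = B e := by rw [hPQB, hBPQ]
  have hPSP : Pᵀ * (∑ e, B e) * P = diagonal fun i => (s i)⁻¹ * v i * (s i)⁻¹ := by
    rw [hP, transpose_mul, diagonal_transpose]
    calc _ = diagonal (fun i => (s i)⁻¹) * (Uᵀ * (∑ e, B e) * U) *
          diagonal fun i => (s i)⁻¹ := by simp only [Matrix.mul_assoc]
      _ = _ := by rw [← hv', diagonal_mul_diagonal, diagonal_mul_diagonal]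
  set X : Option E → Matrix n n ℝ := fun o =>
    o.elim (1 - Pᵀ * (∑ e, B e) * P) fun e => Pᵀ * B e * P with hXdef
  have hX : ∀ o, (X o).PosSemidef := by
    rintro (_ | e)
    · simp only [hXdef, Option.elim]
      rw [hPSP, ← diagonal_one, diagonal_sub]
      refine PosSemidef.diagonal fun i => ?_
      simp only [Pi.zero_apply, sub_nonneg, ← hss]
      by_cases h : s i = 0 <;> simp [h]
    · exact (hB e).transpose_mul_mul_same P
  have hX1 : ∑ o, X o = 1 := by
    rw [Fintype.sum_option]
    simp only [hXdef, Option.elim]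
    rw [← sum_mul, ← mul_sum, sub_add_cancel]
  have hnone : Qᵀ * X none * Q = 0 := by
    have h3 : ∑ e, Qᵀ * (Pᵀ * B e * P) * Q = ∑ e, B e := sum_congr rfl fun e _ => hback e
    rw [← sum_mul, ← mul_sum, ← sum_mul, ← mul_sum] at h3
    simp only [hXdef, Option.elim]
    rw [Matrix.mul_sub, Matrix.sub_mul, Matrix.mul_one, hQQ, h3, sub_self]
  obtain ⟨y, hy, hc, hl, hu⟩ := exists_sparse_sum_of_sum_eq_one hX hX1 hε
  have hsum : Qᵀ * (∑ o, y o • X o) * Q = ∑ e, y (some e) • B e := by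
    rw [Fintype.sum_option, Matrix.mul_add, Matrix.add_mul, Matrix.mul_smul, Matrix.smul_mul,
      hnone, smul_zero, zero_add, mul_sum, sum_mul]
    refine sum_congr rfl fun e _ => ?_
    rw [Matrix.mul_smul, Matrix.smul_mul]
    exact congrArg _ (hback e)
  refine ⟨fun e => y (some e), fun e => hy _, le_trans ?_ hc, ?_, ?_⟩
  · have h3 : #{e | y (some e) ≠ 0} ≤ #{o | y o ≠ 0} :=
      card_le_card_of_injOn some (fun e he => by simpa using he)
        ((Option.some_injective E).injOn)
    exact_mod_cast h3
  · have h3 := hl.transpose_mul_mul_same Q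
    rwa [Matrix.mul_sub, Matrix.sub_mul, hsum, Matrix.mul_one, hQQ] at h3
  · have h3 := hu.transpose_mul_mul_same Q
    rwa [Matrix.mul_sub, Matrix.sub_mul, hsum, Matrix.mul_smul, Matrix.smul_mul, Matrix.mul_one,
      hQQ] at h3

end Matrix

theorem posSemidef_edgeMatrix {n : ℕ} (i j : Fin n) : (edgeMatrix i j).PosSemidef := by
  simpa [edgeMatrix] using Matrix.posSemidef_vecMulVec_self_star
    (Pi.single i 1 - Pi.single j 1 : Fin n → ℝ)

/-- The block-diagonal matrix with blocks `A` and `diagonal v` is positive semidefinite if `A` is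
and `v` is nonnegative. -/
theorem Matrix.PosSemidef.fromBlocks_diagonal {m k : Type*} [Fintype m] [Fintype k] [DecidableEq k]
    {A : Matrix m m ℝ} (hA : A.PosSemidef) {v : k → ℝ} (hv : ∀ i, 0 ≤ v i) :
    (fromBlocks A 0 0 (diagonal v)).PosSemidef := by
  have hD : (diagonal v).PosSemidef := PosSemidef.diagonal hv
  refine .of_dotProduct_mulVec_nonneg
    (IsHermitian.fromBlocks hA.isHermitian (by simp) hD.isHermitian) fun x => ?_
  have h1 := hA.dotProduct_mulVec_nonneg (x ∘ Sum.inl)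
  have h2 := hD.dotProduct_mulVec_nonneg (x ∘ Sum.inr)
  simp only [fromBlocks_mulVec, zero_mulVec, add_zero, zero_add]
  simpa [dotProduct] using add_nonneg h1 h2

/-- **Sparsifiers with costs.** -/
theorem sparsifier_with_costs :
    ∃ C : ℝ, 0 < C ∧
      ∀ (n k : ℕ) (E : Type) (_ : Fintype E) (_ : DecidableEq E)
        (ends : E → Fin n × Fin n), (∀ e, (ends e).1 ≠ (ends e).2) →
        ∀ (w : E → ℝ), (∀ e, 0 ≤ w e) →
        ∀ (c : Fin k → E → ℝ), (∀ i e, 0 ≤ c i e) →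
        ∀ ε : ℝ, ε ∈ Set.Ioo (0 : ℝ) 1 →
          ∃ wH : E → ℝ,
            (∀ e, 0 ≤ wH e) ∧
            ((univ.filter fun e => wH e ≠ 0).card : ℝ) ≤ C * (n + k) / ε ^ 2 ∧
            (weightedLaplacian ends wH - weightedLaplacian ends w).PosSemidef ∧
            ((1 + ε) • weightedLaplacian ends w - weightedLaplacian ends wH).PosSemidef ∧
            ∀ i : Fin k,
              (∑ e, w e * c i e) ≤ (∑ e, wH e * c i e) ∧
              (∑ e, wH e * c i e) ≤ (1 + ε) * ∑ e, w e * c i e := by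
  refine ⟨512, by norm_num, ?_⟩
  intro n k E _ _ ends _ w hw c hc ε hε
  set B : E → Matrix (Fin n ⊕ Fin k) (Fin n ⊕ Fin k) ℝ := fun e =>
    Matrix.fromBlocks (w e • edgeMatrix (ends e).1 (ends e).2) 0 0
      (Matrix.diagonal fun i => w e * c i e) with hBdef
  have hB : ∀ e, (B e).PosSemidef := fun e =>
    ((posSemidef_edgeMatrix _ _).smul (hw e)).fromBlocks_diagonal
      fun i => mul_nonneg (hw e) (hc i e)
  obtain ⟨y, hy, hcard, hl, hu⟩ := Matrix.exists_sparse_sum hB hε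
  have hlap : ∀ z : E → ℝ, (∑ e, z e • B e).submatrix Sum.inl Sum.inl =
      weightedLaplacian ends fun e => w e * z e := fun z => by
    ext i j
    simp only [weightedLaplacian, hBdef, Matrix.submatrix_apply, Matrix.sum_apply,
      Matrix.smul_apply, Matrix.fromBlocks_apply₁₁, smul_eq_mul]
    exact sum_congr rfl fun e _ => by ring
  have hcost : ∀ (z : E → ℝ) (i : Fin k), (∑ e, z e • B e) (Sum.inr i) (Sum.inr i) =
      ∑ e, w e * z e * c i e := fun z i => by
    simp only [hBdef, Matrix.sum_apply, Matrix.smul_apply, Matrix.fromBlocks_apply₂₂,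
      Matrix.diagonal_apply_eq, smul_eq_mul]
    exact sum_congr rfl fun e _ => by ring
  have hlap1 : (∑ e, B e).submatrix Sum.inl Sum.inl = weightedLaplacian ends w := by
    simpa using hlap 1
  have hcost1 : ∀ i : Fin k, (∑ e, B e) (Sum.inr i) (Sum.inr i) = ∑ e, w e * c i e := fun i => by
    simpa using hcost 1 i
  refine ⟨fun e => w e * y e, fun e => mul_nonneg (hw e) (hy e), ?_, ?_, ?_, fun i => ⟨?_, ?_⟩⟩
  · have h1 : #{e | w e * y e ≠ 0} ≤ #{e | y e ≠ 0} :=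
      card_le_card fun e he => by
        simp only [mem_filter, mem_univ, true_and] at he ⊢
        exact right_ne_zero_of_mul he
    have h2 : (Fintype.card (Fin n ⊕ Fin k) : ℝ) = n + k := by simp
    rw [← h2]
    exact le_trans (by exact_mod_cast h1) hcard
  · simpa [Matrix.submatrix_sub, hlap, hlap1] using hl.submatrix Sum.inl
  · simpa [Matrix.submatrix_sub, Matrix.submatrix_smul, hlap, hlap1] using
      hu.submatrix Sum.inl
  · have h := hl.diag_nonneg (i := Sum.inr i)
    rw [Matrix.sub_apply, hcost, hcost1] at h
    simpa using h
  · have h := hu.diag_nonneg (i := Sum.inr i)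
    rw [Matrix.sub_apply, Matrix.smul_apply, hcost, hcost1] at h
    simpa using h
end

section
/- Let A_1, ..., A_m be symmetric positive semidefinite n×n real matrices, let B be a symmetric n×n real matrix, and let c ∈ ℝ^m with c ≥ 0. Suppose z* ∈ ℝ^m satisfies z* ≥ 0 and Σ_i z*_i A_i ⪰ B. Then there is a universal constant C such that for every ε ∈ (0,1) there exists z̄ ∈ ℝ^m with z̄ ≥ 0, Σ_i z̄_i A_i ⪰ B, at most C·n/ε² nonzero entries, and c^T z̄ ≤ (1+ε)·c^T z*. -/
open Finset Matrix

section
variable {n : Type*} [Fintype n] [DecidableEq n]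

theorem exists_orthogonal_diagonalization {A : Matrix n n ℝ} (hA : A.IsHermitian) :
    ∃ (Q : Matrix n n ℝ) (d : n → ℝ), Q * Qᴴ = 1 ∧ Qᴴ * Q = 1 ∧ A = Q * diagonal d * Qᴴ := by
  refine ⟨hA.eigenvectorUnitary, hA.eigenvalues, ?_, ?_, ?_⟩
  · exact Unitary.coe_mul_star_self hA.eigenvectorUnitary
  · exact Unitary.coe_star_mul_self hA.eigenvectorUnitary
  · conv_lhs => rw [hA.spectral_theorem]
    rfl

theorem exists_simultaneous_diagonalization {L V : Matrix n n ℝ} (hL : L.PosDef)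
    (hV : V.IsHermitian) :
    ∃ (T : Matrix n n ℝ) (d : n → ℝ), IsUnit T ∧ Tᴴ * L * T = 1 ∧ Tᴴ * V * T = diagonal d := by
  obtain ⟨P, e, hP, hP', hLe⟩ := exists_orthogonal_diagonalization hL.isHermitian
  have hPL : Pᴴ * L * P = diagonal e := by
    rw [hLe]
    calc Pᴴ * (P * diagonal e * Pᴴ) * P = (Pᴴ * P) * diagonal e * (Pᴴ * P) := by
          simp only [Matrix.mul_assoc]
      _ = diagonal e := by rw [hP', Matrix.one_mul, Matrix.mul_one]
  have hPu : IsUnit P := IsUnit.of_mul_eq_one _ hP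
  have he : ∀ i, 0 < e i := by
    rw [← posDef_diagonal_iff, ← hPL]
    exact (Matrix.IsUnit.posDef_star_left_conjugate_iff hPu).2 hL
  set S : Matrix n n ℝ := P * diagonal fun i => (√(e i))⁻¹ with hS
  have hSL : Sᴴ * L * S = 1 := by
    calc Sᴴ * L * S = diagonal (fun i => (√(e i))⁻¹) * (Pᴴ * L * P) *
          diagonal (fun i => (√(e i))⁻¹) := by
          simp only [hS, conjTranspose_mul, diagonal_conjTranspose, star_trivial, Matrix.mul_assoc]
      _ = 1 := by
          rw [hPL, diagonal_mul_diagonal, diagonal_mul_diagonal, ← diagonal_one]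
          congr 1
          ext i
          have h := Real.sqrt_pos.2 (he i)
          have h2 := Real.mul_self_sqrt (he i).le
          field_simp
          nlinarith
  obtain ⟨Q, d, hQ, hQ', hd⟩ := exists_orthogonal_diagonalization
    (isHermitian_conjTranspose_mul_mul S hV)
  have hT : (S * Q)ᴴ * L * (S * Q) = 1 := by
    calc (S * Q)ᴴ * L * (S * Q) = Qᴴ * (Sᴴ * L * S) * Q := by
          simp only [conjTranspose_mul, Matrix.mul_assoc]
      _ = 1 := by rw [hSL, Matrix.mul_one, hQ']
  refine ⟨S * Q, d, ?_, hT, ?_⟩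
  · exact IsUnit.of_mul_eq_one_right _ hT
  · calc (S * Q)ᴴ * V * (S * Q) = Qᴴ * (Sᴴ * V * S) * Q := by
          simp only [conjTranspose_mul, Matrix.mul_assoc]
      _ = (Qᴴ * Q) * diagonal d * (Qᴴ * Q) := by rw [hd]; simp only [Matrix.mul_assoc]
      _ = diagonal d := by rw [hQ', Matrix.one_mul, Matrix.mul_one]

theorem inv_eq_of_conj_eq_diagonal {T X : Matrix n n ℝ} {e : n → ℝ} (hT : IsUnit T)
    (hX : Tᴴ * X * T = diagonal e) (he : ∀ i, e i ≠ 0) :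
    X⁻¹ = T * diagonal (fun i => (e i)⁻¹) * Tᴴ := by
  apply inv_eq_left_inv
  have h : diagonal (fun i => (e i)⁻¹) * (Tᴴ * X * T) = 1 := by
    rw [hX, diagonal_mul_diagonal, ← diagonal_one]
    congr 1
    ext i
    exact inv_mul_cancel₀ (he i)
  apply hT.mul_right_cancel
  calc T * diagonal (fun i => (e i)⁻¹) * Tᴴ * X * T
      = T * (diagonal (fun i => (e i)⁻¹) * (Tᴴ * X * T)) := by simp only [Matrix.mul_assoc]
    _ = 1 * T := by rw [h, Matrix.mul_one, Matrix.one_mul]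

theorem trace_mul_inv_of_conj_eq_diagonal {T X : Matrix n n ℝ} {e : n → ℝ} (hT : IsUnit T)
    (hX : Tᴴ * X * T = diagonal e) (he : ∀ i, e i ≠ 0) (Y : Matrix n n ℝ) :
    (Y * X⁻¹).trace = ∑ i, (Tᴴ * Y * T) i i * (e i)⁻¹ := by
  rw [inv_eq_of_conj_eq_diagonal hT hX he]
  calc (Y * (T * diagonal (fun i => (e i)⁻¹) * Tᴴ)).trace
      = (Tᴴ * (Y * T * diagonal (fun i => (e i)⁻¹))).trace := by
        rw [trace_mul_comm Tᴴ]; simp only [Matrix.mul_assoc]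
    _ = (Tᴴ * Y * T * diagonal (fun i => (e i)⁻¹)).trace := by simp only [Matrix.mul_assoc]
    _ = _ := by simp [trace, mul_diagonal]

theorem trace_mul_inv_mul_mul_inv_of_conj_eq_diagonal {T X Y : Matrix n n ℝ} {e d : n → ℝ}
    (hT : IsUnit T) (hX : Tᴴ * X * T = diagonal e) (he : ∀ i, e i ≠ 0)
    (hY : Tᴴ * Y * T = diagonal d) (Z : Matrix n n ℝ) :
    (Z * X⁻¹ * Y * X⁻¹).trace = ∑ i, (Tᴴ * Z * T) i i * ((e i)⁻¹ * d i * (e i)⁻¹) := by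
  rw [inv_eq_of_conj_eq_diagonal hT hX he]
  set E := diagonal (fun i => (e i)⁻¹)
  calc (Z * (T * E * Tᴴ) * Y * (T * E * Tᴴ)).trace
      = (Tᴴ * (Z * T * E * (Tᴴ * Y * T) * E)).trace := by
        rw [trace_mul_comm Tᴴ]; simp only [Matrix.mul_assoc]
    _ = (Tᴴ * Z * T * (E * (Tᴴ * Y * T) * E)).trace := by simp only [Matrix.mul_assoc]
    _ = _ := by 
        rw [hY]
        simp only [E, trace, diag_apply, diagonal_mul_diagonal, mul_diagonal]

/-- Adding `t • V` to `L` decreases the barrier `trace (M * L⁻¹)` by at least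
`trace (M L⁻¹ V L⁻¹) / (t⁻¹ + trace (V L⁻¹))`. -/
theorem trace_mul_inv_add_smul_le {L V M : Matrix n n ℝ} (hL : L.PosDef) (hV : V.PosSemidef)
    (hM : M.PosSemidef) {t : ℝ} (ht : 0 < t) :
    (M * (L + t • V)⁻¹).trace ≤
      (M * L⁻¹).trace - (M * L⁻¹ * V * L⁻¹).trace / (t⁻¹ + (V * L⁻¹).trace) := by
  obtain ⟨T, d, hT, hTL, hTV⟩ := exists_simultaneous_diagonalization hL hV.isHermitian
  have hTL' : Tᴴ * L * T = diagonal (fun _ => 1) := by rw [hTL, diagonal_one]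
  have hd : ∀ i, 0 ≤ d i := by
    have := hV.conjTranspose_mul_mul_same T
    rwa [hTV, posSemidef_diagonal_iff] at this
  have hg : ∀ i, 0 ≤ (Tᴴ * M * T) i i := fun i => (hM.conjTranspose_mul_mul_same T).diag_nonneg
  have hTX : Tᴴ * (L + t • V) * T = diagonal (fun i => 1 + t * d i) := by
    rw [Matrix.mul_add, Matrix.add_mul, hTL', Matrix.mul_smul, Matrix.smul_mul, hTV,
      ← diagonal_smul, diagonal_add]
    rfl
  have hpos : ∀ i, 0 < 1 + t * d i := fun i => by have := mul_nonneg ht.le (hd i); linarith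
  rw [trace_mul_inv_mul_mul_inv_of_conj_eq_diagonal hT hTL' (fun _ => one_ne_zero) hTV,
    trace_mul_inv_of_conj_eq_diagonal hT hTX (fun i => (hpos i).ne'),
    trace_mul_inv_of_conj_eq_diagonal hT hTL' (fun _ => one_ne_zero) M,
    trace_mul_inv_of_conj_eq_diagonal hT hTL' (fun _ => one_ne_zero) V, hTV,
    sum_div, ← sum_sub_distrib]
  refine sum_le_sum fun i _ => ?_
  simp only [diagonal_apply_eq, inv_one, mul_one, one_mul]
  have hκ : d i ≤ ∑ j, d j := single_le_sum (fun j _ => hd j) (mem_univ i)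
  have hκ0 := (hd i).trans hκ
  have key : (1 + t * d i)⁻¹ ≤ 1 - d i / (t⁻¹ + ∑ j, d j) := by
    have h1 : d i / (t⁻¹ + ∑ j, d j) ≤ d i / (t⁻¹ + d i) :=
      div_le_div_of_nonneg_left (hd i) (by have := inv_pos.2 ht; linarith [hd i]) (by linarith)
    have h2 : (1 + t * d i)⁻¹ = 1 - d i / (t⁻¹ + d i) := by
      have := (hpos i).ne'
      have h3 : t⁻¹ + d i = (1 + t * d i) / t := by field_simp
      rw [h3]
      field_simp
      ring
    linarith
  calc _ ≤ (Tᴴ * M * T) i i * (1 - d i / (t⁻¹ + ∑ j, d j)) :=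
        mul_le_mul_of_nonneg_left key (hg i)
    _ = _ := by ring

/-- Shifting `L` by `-M`: the barrier stays finite, and its increase is controlled. -/
theorem barrier_shift {L M : Matrix n n ℝ} [Nonempty n] (hM : M.PosDef) (hL : L.PosDef)
    (hφ : (M * L⁻¹).trace < 1) :
    (L - M).PosDef ∧ (M * L⁻¹).trace < (M * (L - M)⁻¹).trace ∧
    (1 - (M * L⁻¹).trace + (M * (L - M)⁻¹).trace) *
        ((M * (L - M)⁻¹).trace - (M * L⁻¹).trace) ≤
      (M * (L - M)⁻¹ * M * (L - M)⁻¹).trace := by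
  obtain ⟨T, μ, hT, hTM, hTL⟩ := exists_simultaneous_diagonalization hM hL.isHermitian
  have hTM' : Tᴴ * M * T = diagonal (fun _ => 1) := by rw [hTM, diagonal_one]
  have hμ : ∀ i, 0 < μ i := by
    have := (Matrix.IsUnit.posDef_star_left_conjugate_iff hT).2 hL
    rwa [star_eq_conjTranspose, hTL, posDef_diagonal_iff] at this
  have hTX : Tᴴ * (L - M) * T = diagonal (fun i => μ i - 1) := by
    rw [Matrix.mul_sub, Matrix.sub_mul, hTM', hTL, diagonal_sub]
  have hφL := trace_mul_inv_of_conj_eq_diagonal hT hTL (fun i => (hμ i).ne') M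
  simp only [hTM, one_apply_eq, one_mul] at hφL
  have hμ1 : ∀ i, 0 < μ i - 1 := fun i => by
    have h : (μ i)⁻¹ ≤ ∑ j, (μ j)⁻¹ :=
      single_le_sum (f := fun j => (μ j)⁻¹) (fun j _ => (inv_pos.2 (hμ j)).le) (mem_univ i)
    have h' : (μ i)⁻¹ < 1 := by linarith
    have := (inv_lt_one₀ (hμ i)).1 h'
    linarith
  have hφX := trace_mul_inv_of_conj_eq_diagonal hT hTX (fun i => (hμ1 i).ne') M
  have hψX := trace_mul_inv_mul_mul_inv_of_conj_eq_diagonal hT hTX (fun i => (hμ1 i).ne') hTM' M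
  simp only [hTM, one_apply_eq, one_mul, mul_one] at hφX hψX
  rw [hφL] at hφ
  rw [hφL, hφX, hψX]
  have hdiff : ∑ i, (μ i - 1)⁻¹ - ∑ i, (μ i)⁻¹ = ∑ i, (μ i)⁻¹ * (μ i - 1)⁻¹ := by
    rw [← sum_sub_distrib]
    refine sum_congr rfl fun i _ => ?_
    have := (hμ i).ne'
    have := (hμ1 i).ne'
    field_simp
    ring
  refine ⟨?_, ?_, ?_⟩
  · rw [← Matrix.IsUnit.posDef_star_left_conjugate_iff hT, star_eq_conjTranspose, hTX,
      posDef_diagonal_iff]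
    exact hμ1
  · have : 0 < ∑ i, (μ i)⁻¹ * (μ i - 1)⁻¹ :=
      sum_pos (fun i _ => mul_pos (inv_pos.2 (hμ i)) (inv_pos.2 (hμ1 i))) univ_nonempty
    linarith
  · set D := ∑ i, (μ i)⁻¹ * (μ i - 1)⁻¹ with hD
    set E := ∑ i, (μ i)⁻¹ * ((μ i - 1)⁻¹ * (μ i - 1)⁻¹) with hE
    have hsum : ∑ i, (μ i - 1)⁻¹ * (μ i - 1)⁻¹ = D + E := by
      rw [hD, hE, ← sum_add_distrib]
      refine sum_congr rfl fun i _ => ?_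
      have := (hμ i).ne'
      have := (hμ1 i).ne'
      field_simp
      ring
    have hE0 : 0 ≤ E := sum_nonneg fun i _ =>
      mul_nonneg (inv_pos.2 (hμ i)).le (mul_self_nonneg _)
    have hCS : D ^ 2 ≤ (∑ i, (μ i)⁻¹) * E := by
      refine sum_sq_le_sum_mul_sum_of_sq_le_mul univ (fun i _ => (inv_pos.2 (hμ i)).le)
        (fun i _ => mul_nonneg (inv_pos.2 (hμ i)).le (mul_self_nonneg _)) fun i _ => le_of_eq ?_
      ring
    have : (∑ i, (μ i)⁻¹) * E ≤ 1 * E := mul_le_mul_of_nonneg_right hφ.le hE0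
    rw [hsum, hdiff, show 1 - ∑ i, (μ i)⁻¹ + ∑ i, (μ i - 1)⁻¹ = 1 + D by linarith]
    nlinarith

variable {ι : Type*} [Fintype ι]

theorem exists_barrier_step [Nonempty n] {V : ι → Matrix n n ℝ} (hV : ∀ i, (V i).PosSemidef)
    {M : Matrix n n ℝ} (hVM : ∑ i, V i = M) (hM : M.PosDef) {c : ι → ℝ} (hc : ∀ i, 0 ≤ c i)
    {φ : ℝ} (hφ : φ < 1) {L : Matrix n n ℝ} (hL : L.PosDef) (hLφ : (M * L⁻¹).trace ≤ φ) :
    ∃ (i : ι) (t : ℝ), 0 < t ∧ c i * t ≤ (∑ j, c j) / (1 - φ) ∧ (L - M + t • V i).PosDef ∧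
      (M * (L - M + t • V i)⁻¹).trace ≤ φ := by
  obtain ⟨hX, hab, hψ⟩ := barrier_shift hM hL (hLφ.trans_lt hφ)
  set X := L - M
  set a := (M * L⁻¹).trace
  set b := (M * X⁻¹).trace with hb
  have hba : 0 < b - a := sub_pos.2 hab
  set G : ι → ℝ := fun i => (M * X⁻¹ * V i * X⁻¹).trace / (b - a) - (V i * X⁻¹).trace with hG
  have hGsum : 1 - φ ≤ ∑ i, G i := by
    have h : ∑ i, G i = (M * X⁻¹ * M * X⁻¹).trace / (b - a) - b := by
      simp only [hG, sum_sub_distrib, ← sum_div, ← trace_sum, ← Matrix.sum_mul,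
        ← Matrix.mul_sum, hVM, hb]
    have := (le_div_iff₀ hba).2 hψ
    linarith
  have h1φ : 0 < 1 - φ := by linarith
  have hc0 : 0 ≤ ∑ j, c j := sum_nonneg fun j _ => hc j
  obtain ⟨i, hGi, hci⟩ : ∃ i, 0 < G i ∧ c i * (1 - φ) ≤ (∑ j, c j) * G i := by
    by_contra! h
    have hle : ∀ i, (∑ j, c j) * G i ≤ c i * (1 - φ) := fun i => by
      rcases le_or_gt (G i) 0 with hi | hi
      · exact (mul_nonpos_of_nonneg_of_nonpos hc0 hi).trans (mul_nonneg (hc i) h1φ.le)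
      · exact (h i hi).le
    obtain ⟨i, -, hi⟩ := exists_lt_of_sum_lt (s := univ) (f := fun _ => (0 : ℝ)) (g := G)
      (by simpa using h1φ.trans_le hGsum)
    have hlt : ∑ i, (∑ j, c j) * G i < ∑ i, c i * (1 - φ) :=
      sum_lt_sum (fun i _ => hle i) ⟨i, mem_univ i, h i hi⟩
    rw [← mul_sum, ← sum_mul] at hlt
    exact absurd (mul_le_mul_of_nonneg_left hGsum hc0) (not_le.2 hlt)
  have ht : 0 < (G i)⁻¹ := inv_pos.2 hGi
  refine ⟨i, (G i)⁻¹, ht, ?_, hX.add_posSemidef ((hV i).smul ht.le), ?_⟩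
  · rw [le_div_iff₀ h1φ, mul_right_comm, ← div_eq_mul_inv, div_le_iff₀ hGi]
    exact hci
  · refine (trace_mul_inv_add_smul_le hX (hV i) hM.posSemidef ht).trans ?_
    have hVX : 0 ≤ (V i * X⁻¹).trace := by
      obtain ⟨T, d, hT, hTX, hTV⟩ := exists_simultaneous_diagonalization hX (hV i).isHermitian
      rw [trace_mul_inv_of_conj_eq_diagonal hT (hTX.trans diagonal_one.symm)
        fun _ => one_ne_zero]
      exact sum_nonneg fun j _ =>
        mul_nonneg ((hV i).conjTranspose_mul_mul_same T).diag_nonneg (by simp)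
    have hsum : (G i)⁻¹⁻¹ + (V i * X⁻¹).trace = (M * X⁻¹ * V i * X⁻¹).trace / (b - a) := by
      rw [inv_inv, hG]
      ring
    have hpos : 0 < (M * X⁻¹ * V i * X⁻¹).trace / (b - a) := by
      rw [← hsum, inv_inv]
      linarith
    have hP : (M * X⁻¹ * V i * X⁻¹).trace ≠ 0 := fun h => by simp [h] at hpos
    rw [hsum, div_div_cancel₀ hP]
    linarith

theorem exists_barrier_iterate [Nonempty n] {V : ι → Matrix n n ℝ}
    (hV : ∀ i, (V i).PosSemidef) {M : Matrix n n ℝ} (hVM : ∑ i, V i = M) (hM : M.PosDef)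
    {c : ι → ℝ} (hc : ∀ i, 0 ≤ c i) {φ : ℝ} (hφ0 : 0 < φ) (hφ : φ < 1) (k : ℕ) :
    ∃ s : ι → ℝ, (∀ i, 0 ≤ s i) ∧ #{i | s i ≠ 0} ≤ k ∧
      ∑ i, c i * s i ≤ k * ((∑ i, c i) / (1 - φ)) ∧
      (((Fintype.card n : ℝ) / φ - k) • M + ∑ i, s i • V i).PosDef ∧
      (M * (((Fintype.card n : ℝ) / φ - k) • M + ∑ i, s i • V i)⁻¹).trace ≤ φ := by
  classical
  induction k with
  | zero =>
    have hn : (0 : ℝ) < Fintype.card n := by exact_mod_cast Fintype.card_pos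
    have ha : 0 < (Fintype.card n : ℝ) / φ := div_pos hn hφ0
    refine ⟨0, fun _ => le_rfl, by simp, by simp, by simpa using hM.smul ha, le_of_eq ?_⟩
    have hdet : IsUnit M.det := (Matrix.isUnit_iff_isUnit_det M).1 hM.isUnit
    have hinv : ((Fintype.card n : ℝ) / φ) • M * ((φ / Fintype.card n) • M⁻¹) = 1 := by
      rw [Matrix.smul_mul, Matrix.mul_smul, smul_smul, mul_nonsing_inv _ hdet]
      field_simp
      simp
    simp only [Nat.cast_zero, sub_zero, Pi.zero_apply, zero_smul, sum_const_zero, add_zero]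
    rw [inv_eq_right_inv hinv, Matrix.mul_smul, mul_nonsing_inv _ hdet, trace_smul, trace_one,
      smul_eq_mul, div_mul_cancel₀ _ hn.ne']
  | succ k ih =>
    obtain ⟨s, hs, hcard, hcost, hL, hLφ⟩ := ih
    obtain ⟨i, t, ht, hct, hL', hLφ'⟩ := exists_barrier_step hV hVM hM hc hφ hL hLφ
    have heq : ((Fintype.card n : ℝ) / φ - (k + 1 : ℕ)) • M +
        ∑ j, (s + Pi.single i t : ι → ℝ) j • V j =
        ((Fintype.card n : ℝ) / φ - k) • M + ∑ j, s j • V j - M + t • V i := by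
      have : ∑ j, (Pi.single i t : ι → ℝ) j • V j = t • V i := by
        rw [sum_eq_single i] <;> simp +contextual
      simp only [Pi.add_apply, add_smul, sum_add_distrib, this]
      push_cast
      module
    refine ⟨s + Pi.single i t, fun j => ?_, ?_, ?_, by rw [heq]; exact hL',
      by rw [heq]; exact hLφ'⟩
    · have : 0 ≤ (Pi.single i t : ι → ℝ) j := by
        rw [Pi.single_apply]
        split_ifs <;> simp [ht.le]
      exact add_nonneg (hs j) this
    · refine (card_le_card (t := insert i ({j | s j ≠ 0} : Finset ι)) fun j hj => ?_).trans
        ((card_insert_le _ _).trans (Nat.add_le_add_right hcard 1))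
      by_cases hji : j = i
      · simp [hji]
      · simpa [hji] using hj
    · have : ∑ j, c j * (Pi.single i t : ι → ℝ) j = c i * t := by
        rw [sum_eq_single i] <;> simp +contextual
      simp only [Pi.add_apply, mul_add, sum_add_distrib, this]
      push_cast
      linarith

theorem exists_sparse_weights_of_posDef {V : ι → Matrix n n ℝ} (hV : ∀ i, (V i).PosSemidef)
    (hM : (∑ i, V i).PosDef) {c : ι → ℝ} (hc : ∀ i, 0 ≤ c i) {ε : ℝ}
    (hε : ε ∈ Set.Ioo (0 : ℝ) 1) :
    ∃ s : ι → ℝ, (∀ i, 0 ≤ s i) ∧ (∑ i, s i • V i - ∑ i, V i).PosSemidef ∧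
      (#{i | s i ≠ 0} : ℝ) ≤ 17 * Fintype.card n / ε ^ 2 ∧
      ∑ i, c i * s i ≤ (1 + ε) * ∑ i, c i := by
  obtain ⟨hε0, hε1⟩ := hε
  have hc0 : 0 ≤ ∑ j, c j := sum_nonneg fun j _ => hc j
  rcases isEmpty_or_nonempty n with hn | hn
  · refine ⟨0, fun _ => le_rfl, ?_, by simp, ?_⟩
    · rw [Subsingleton.elim (_ - _) (0 : Matrix n n ℝ)]
      exact PosSemidef.zero
    · simpa using mul_nonneg (by linarith) hc0
  have hn1 : (1 : ℝ) ≤ Fintype.card n := by exact_mod_cast Fintype.card_pos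
  set r : ℝ := (Fintype.card n : ℝ)
  set N := ⌈16 * r / ε ^ 2⌉₊
  have hN : 16 * r / ε ^ 2 ≤ N := Nat.le_ceil _
  have hN' : (N : ℝ) ≤ 17 * r / ε ^ 2 := by
    have h1 : (N : ℝ) < 16 * r / ε ^ 2 + 1 := Nat.ceil_lt_add_one (by positivity)
    have h2 : 1 ≤ r / ε ^ 2 := by
      rw [le_div_iff₀ (by positivity)]
      nlinarith
    have h3 : 17 * r / ε ^ 2 = 16 * r / ε ^ 2 + r / ε ^ 2 := by ring
    linarith
  obtain ⟨s, hs, hcard, hcost, hpos, -⟩ := exists_barrier_iterate hV rfl hM hc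
    (φ := ε / 4) (by linarith) (by linarith) N
  have hNpos : (0 : ℝ) < N := lt_of_lt_of_le (by positivity) hN
  have hrN : r / (ε / 4) ≤ ε / 4 * N := by
    have : r / (ε / 4) = ε / 4 * (16 * r / ε ^ 2) := by field_simp; norm_num
    rw [this]
    gcongr
  set a := N - r / (ε / 4) with ha
  have haN : (1 - ε / 4) * N ≤ a := by linarith
  have ha0 : 0 < a := lt_of_lt_of_le (mul_pos (by linarith) hNpos) haN
  refine ⟨fun i => a⁻¹ * s i, fun i => mul_nonneg (inv_pos.2 ha0).le (hs i), ?_, ?_, ?_⟩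
  · have : ∑ i, (a⁻¹ * s i) • V i - ∑ i, V i =
        a⁻¹ • ((r / (ε / 4) - N) • ∑ i, V i + ∑ i, s i • V i) := by
      have h : r / (ε / 4) - N = -a := by rw [ha]; ring
      rw [h, smul_add, smul_smul, smul_sum (s := univ) (f := fun i => s i • V i)]
      simp only [smul_smul]
      rw [mul_neg, inv_mul_cancel₀ ha0.ne', neg_one_smul]
      abel
    rw [this]
    exact hpos.posSemidef.smul (inv_pos.2 ha0).le
  · refine le_trans ?_ hN'
    have : ∀ i, a⁻¹ * s i ≠ 0 ↔ s i ≠ 0 := fun i => by simp [ha0.ne']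
    simp only [this]
    exact_mod_cast hcard
  · have h1 : ∑ i, c i * (a⁻¹ * s i) = (∑ i, c i * s i) / a := by
      rw [sum_div]
      exact sum_congr rfl fun i _ => by ring
    have hε4 : 0 < 1 - ε / 4 := by linarith
    rw [h1, div_le_iff₀ ha0]
    refine hcost.trans ?_
    have h2 : (1 : ℝ) / (1 - ε / 4) ≤ (1 + ε) * (1 - ε / 4) := by
      rw [div_le_iff₀ hε4]
      nlinarith [mul_pos hε0 hε0, mul_pos hε0 (sub_pos.2 hε1),
        mul_pos (mul_pos hε0 hε0) hε0, mul_pos (mul_pos hε0 hε0) (sub_pos.2 hε1)]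
    calc (N : ℝ) * ((∑ i, c i) / (1 - ε / 4)) = N * (∑ i, c i) * (1 / (1 - ε / 4)) := by ring
      _ ≤ N * (∑ i, c i) * ((1 + ε) * (1 - ε / 4)) := by gcongr
      _ = (1 + ε) * (∑ i, c i) * ((1 - ε / 4) * N) := by ring
      _ ≤ (1 + ε) * (∑ i, c i) * a := by gcongr

theorem exists_kernel_projection {M : Matrix n n ℝ} (hM : M.PosSemidef) :
    ∃ N : Matrix n n ℝ, N.PosSemidef ∧ N * N = N ∧ M * N = 0 ∧ (M + N).PosDef := by
  obtain ⟨Q, d, hQ, hQ', hd⟩ := exists_orthogonal_diagonalization hM.isHermitian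
  have hQu : IsUnit Q := IsUnit.of_mul_eq_one _ hQ
  have hd0 : ∀ i, 0 ≤ d i := by
    rw [← posSemidef_diagonal_iff,
      ← Matrix.IsUnit.posSemidef_star_right_conjugate_iff hQu, star_eq_conjTranspose, ← hd]
    exact hM
  have hmul : ∀ x y : n → ℝ, Q * diagonal x * Qᴴ * (Q * diagonal y * Qᴴ) =
      Q * diagonal (fun i => x i * y i) * Qᴴ := fun x y => by
    calc Q * diagonal x * Qᴴ * (Q * diagonal y * Qᴴ)
        = Q * diagonal x * (Qᴴ * Q) * diagonal y * Qᴴ := by simp only [Matrix.mul_assoc]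
      _ = Q * diagonal (fun i => x i * y i) * Qᴴ := by
        rw [hQ', Matrix.mul_one, Matrix.mul_assoc Q, diagonal_mul_diagonal]
  refine ⟨Q * diagonal (fun i => if d i = 0 then 1 else 0) * Qᴴ, ?_, ?_, ?_, ?_⟩
  · refine (PosSemidef.diagonal fun i => ?_).mul_mul_conjTranspose_same Q
    dsimp only [Pi.zero_apply]
    split_ifs <;> norm_num
  · rw [hmul]
    congr 3
    ext i
    split_ifs <;> norm_num
  · have : (fun i => d i * if d i = 0 then 1 else 0) = 0 := by
      ext i
      split_ifs with h <;> simp [h]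
    rw [hd, hmul, this, Pi.zero_def, diagonal_zero, Matrix.mul_zero, Matrix.zero_mul]
  · rw [hd, ← Matrix.add_mul, ← Matrix.mul_add, diagonal_add, ← star_eq_conjTranspose,
      Matrix.IsUnit.posDef_star_right_conjugate_iff hQu, posDef_diagonal_iff]
    intro i
    rcases (hd0 i).eq_or_lt with h | h
    · simp [← h]
    · simp [h.ne', h]

theorem mul_eq_zero_of_sum_mul_eq_zero {V : ι → Matrix n n ℝ} (hV : ∀ i, (V i).PosSemidef)
    {N : Matrix n n ℝ} (h : (∑ i, V i) * N = 0) (i : ι) : V i * N = 0 := by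
  have hpsd : ∀ j, (Nᴴ * V j * N).PosSemidef := fun j => (hV j).conjTranspose_mul_mul_same N
  have hsum : ∑ j, (Nᴴ * V j * N).trace = 0 := by
    rw [← trace_sum, ← Matrix.sum_mul, ← Matrix.mul_sum, Matrix.mul_assoc, h, Matrix.mul_zero,
      trace_zero]
  have hi := (sum_eq_zero_iff_of_nonneg fun j _ => (hpsd j).trace_nonneg).1 hsum i (mem_univ i)
  rw [(hpsd i).trace_eq_zero_iff] at hi
  refine Matrix.ext_of_mulVec_single fun j => ?_
  rw [← mulVec_mulVec, zero_mulVec, ← (hV i).dotProduct_mulVec_zero_iff, star_mulVec,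
    ← dotProduct_mulVec, mulVec_mulVec, mulVec_mulVec, hi]
  simp

/-- One-sided spectral sparsification of a sum of positive semidefinite matrices, with control
of a linear cost. -/
theorem exists_sparse_weights {V : ι → Matrix n n ℝ} (hV : ∀ i, (V i).PosSemidef)
    {c : ι → ℝ} (hc : ∀ i, 0 ≤ c i) {ε : ℝ} (hε : ε ∈ Set.Ioo (0 : ℝ) 1) :
    ∃ s : ι → ℝ, (∀ i, 0 ≤ s i) ∧ (∑ i, s i • V i - ∑ i, V i).PosSemidef ∧
      (#{i | s i ≠ 0} : ℝ) ≤ 17 * Fintype.card n / ε ^ 2 ∧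
      ∑ i, c i * s i ≤ (1 + ε) * ∑ i, c i := by
  rcases isEmpty_or_nonempty ι with hι | hι
  · exact ⟨0, fun _ => le_rfl, by simpa using PosSemidef.zero,
      by simpa using by positivity, by simp⟩
  have hMpsd : (∑ i, V i).PosSemidef := posSemidef_sum univ fun i _ => hV i
  obtain ⟨N, hN, hNN, hMN, hMN'⟩ := exists_kernel_projection hMpsd
  have hVN := mul_eq_zero_of_sum_mul_eq_zero hV hMN
  have hNV : ∀ i, N * V i = 0 := fun i => by
    have := congrArg conjTranspose (hVN i)
    rwa [conjTranspose_mul, hN.isHermitian, (hV i).isHermitian, conjTranspose_zero] at this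
  set w : ℝ := (Fintype.card ι : ℝ)⁻¹
  have hw : 0 ≤ w := by positivity
  have hsum : ∑ i, (V i + w • N) = ∑ i, V i + N := by
    rw [sum_add_distrib, sum_const, card_univ, ← Nat.cast_smul_eq_nsmul ℝ, smul_smul,
      mul_inv_cancel₀ (by simp), one_smul]
  obtain ⟨s, hs, hpsd, hcard, hcost⟩ := exists_sparse_weights_of_posDef
    (V := fun i => V i + w • N) (fun i => (hV i).add (hN.smul hw)) (hsum ▸ hMN') hc hε
  refine ⟨s, hs, ?_, hcard, hcost⟩
  have hP := hpsd.conjTranspose_mul_mul_same (1 - N)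
  have hconjV : ∀ i, (1 - N)ᴴ * V i * (1 - N) = V i := fun i => by
    rw [conjTranspose_sub, conjTranspose_one, hN.isHermitian, Matrix.mul_sub, Matrix.mul_one,
      Matrix.mul_assoc, hVN, Matrix.mul_zero, sub_zero, Matrix.sub_mul, hNV, Matrix.one_mul,
      sub_zero]
  have hconjN : (1 - N)ᴴ * N * (1 - N) = 0 := by
    rw [Matrix.mul_assoc, Matrix.mul_sub, Matrix.mul_one, hNN, sub_self, Matrix.mul_zero]
  rw [hsum] at hP
  simpa only [Matrix.mul_sub (1 - N)ᴴ, Matrix.sub_mul _ _ (1 - N), Matrix.mul_add,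
    Matrix.add_mul, Matrix.mul_sum, Matrix.sum_mul, Matrix.mul_smul, Matrix.smul_mul, hconjV,
    hconjN, smul_zero, add_zero] using hP

end

/-- **Sparse solutions to semidefinite programs.** -/
theorem sparse_sdp_solution :
    ∃ C : ℝ, 0 < C ∧
      ∀ (n m : ℕ) (A : Fin m → Matrix (Fin n) (Fin n) ℝ),
        (∀ i, (A i).PosSemidef) →
        ∀ (B : Matrix (Fin n) (Fin n) ℝ), B.IsSymm →
        ∀ (c : Fin m → ℝ), (∀ i, 0 ≤ c i) →
        ∀ (z : Fin m → ℝ), (∀ i, 0 ≤ z i) →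
          ((∑ i, z i • A i) - B).PosSemidef →
        ∀ ε : ℝ, ε ∈ Set.Ioo (0 : ℝ) 1 →
          ∃ zbar : Fin m → ℝ,
            (∀ i, 0 ≤ zbar i) ∧
            ((∑ i, zbar i • A i) - B).PosSemidef ∧
            ((univ.filter fun i => zbar i ≠ 0).card : ℝ) ≤ C * n / ε ^ 2 ∧
            (∑ i, c i * zbar i) ≤ (1 + ε) * ∑ i, c i * z i := by
  refine ⟨17, by norm_num, fun n m A hA B _ c hc z hz hB ε hε => ?_⟩
  obtain ⟨s, hs, hpsd, hcard, hcost⟩ := exists_sparse_weights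
    (V := fun i => z i • A i) (fun i => (hA i).smul (hz i)) (c := fun i => c i * z i)
    (fun i => mul_nonneg (hc i) (hz i)) hε
  refine ⟨fun i => s i * z i, fun i => mul_nonneg (hs i) (hz i), ?_, ?_, ?_⟩
  · have := hpsd.add hB
    simpa only [sub_add_sub_cancel, smul_smul] using this
  · rw [Fintype.card_fin] at hcard
    refine le_trans ?_ hcard
    exact_mod_cast card_le_card (monotone_filter_right _ fun i _ h => left_ne_zero_of_mul h)
  · refine le_trans (le_of_eq (sum_congr rfl fun i _ => ?_)) hcost
    ring
end
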